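/- Let I ⊆ P = P(d,m) be a color-squarefree monomial ideal. Then the ideal I + 𝔪_1^{[2]} + ⋯ + 𝔪_d^{[2]} + Σ_{i=1}^d x_{i,m_i+1}·𝔪_i of P' = P(d, m+(1,…,1)) and the ideal I + 𝔪_1² + ⋯ + 𝔪_d² of P have the same ℤ^d-graded Betti numbers; that is, for all k ≥ 0 and all a ∈ ℤ^d, dim_K Tor_k^{P'}(P'/(I + Σ𝔪_i^{[2]} + Σ x_{i,m_i+1}𝔪_i), K)_a = dim_K Tor_k^{P}(P/(I + Σ𝔪_i²), K)_a. -/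

import Mathlib

open Finset

noncomputable section

namespace BalSq

variable {d : ℕ} {m : Fin d → ℕ}

/-- The set of variables `x_{i,j}` of `P(d,m)`: the variable `⟨i,j⟩` has color `i`. -/
abbrev Var (d : ℕ) (m : Fin d → ℕ) : Type := Σ i : Fin d, Fin (m i)

/-- Monomials of `P(d,m)`, encoded as exponent vectors. -/
abbrev Mon (d : ℕ) (m : Fin d → ℕ) : Type := Var d m →₀ ℕ

/-- The vertex set `V = V_1 ∪ ⋯ ∪ V_d`, where `V_i` has `m i + 1` elements;
these are also the variables of `P(d, m + (1,…,1))`. -/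
abbrev Vtx (d : ℕ) (m : Fin d → ℕ) : Type := Σ i : Fin d, Fin (m i + 1)

/-- The monomial `x_{i,j}`. -/
def xvar (i : Fin d) (j : Fin (m i)) : Mon d m := Finsupp.single ⟨i, j⟩ 1

/-- Total degree of a monomial. -/
def deg (u : Mon d m) : ℕ := u.sum fun _ n => n

/-- A monomial is color-squarefree if it is divisible by at most one variable of each color. -/
def ColorSquarefree (u : Mon d m) : Prop :=
  ∀ i : Fin d, (∑ j : Fin (m i), u ⟨i, j⟩) ≤ 1

/-- A color-squarefree monomial order ideal: a finite set of color-squarefree monomials,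
closed under divisibility, containing `1` and all the variables. -/
def IsOrderIdeal (U : Finset (Mon d m)) : Prop :=
  (∀ u ∈ U, ColorSquarefree u) ∧
  (∀ u ∈ U, ∀ v : Mon d m, v ≤ u → v ∈ U) ∧
  ((0 : Mon d m) ∈ U) ∧
  (∀ (i : Fin d) (j : Fin (m i)), xvar i j ∈ U)

/-- The strict order `≺` on variables: `x_{i,j} ≺ x_{k,ℓ}` iff `i < k`, or `i = k` and `j < ℓ`. -/
def vlt (a b : Var d m) : Prop :=
  a.1 < b.1 ∨ (a.1 = b.1 ∧ (a.2 : ℕ) < (b.2 : ℕ))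

variable (K : Type*) [Field K]

/-- The polynomial ring `P(d,m)`. -/
abbrev PR (d : ℕ) (m : Fin d → ℕ) (K : Type*) [Field K] : Type _ :=
  MvPolynomial (Var d m) K

/-- The monomial of `P(d,m)` with exponent vector `u`. -/
def mon (u : Mon d m) : PR d m K := MvPolynomial.monomial u 1

/-- The ideal `I(U)` generated by all monomials of `P(d,m)` not lying in `U`. -/
def IU (U : Finset (Mon d m)) : Ideal (PR d m K) :=
  Ideal.span { p : PR d m K | ∃ u : Mon d m, u ∉ U ∧ p = mon K u }

/-- The ideal `𝔪_1^2 + ⋯ + 𝔪_d^2` of `P(d,m)`. -/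
def sqIdeal : Ideal (PR d m K) :=
  Ideal.span { p : PR d m K | ∃ (i : Fin d) (j k : Fin (m i)),
    p = mon K (xvar i j + xvar i k) }

/-- A monomial ideal is strongly color-stable if `x_{k,ℓ}·u ∈ I` and `j < ℓ` imply
`x_{k,j}·u ∈ I`. -/
def StronglyColorStable (I : Ideal (PR d m K)) : Prop :=
  ∀ (u : Mon d m) (k : Fin d) (l j : Fin (m k)),
    mon K (xvar k l + u) ∈ I → j < l → mon K (xvar k j + u) ∈ I

/-- Strongly color-stable across colors. -/
def StronglyColorStableAcross (I : Ideal (PR d m K)) : Prop :=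
  StronglyColorStable K I ∧
  ∀ (u : Mon d m) (k : Fin d) (l : Fin (m k)) (i : Fin d) (j : Fin (m i)),
    ColorSquarefree (xvar k l + u) → mon K (xvar k l + u) ∈ I →
    vlt ⟨i, j⟩ ⟨k, l⟩ → ColorSquarefree (xvar i j + u) → mon K (xvar i j + u) ∈ I

/-- The minimal monomial generators of a monomial ideal. -/
def MinGens (I : Ideal (PR d m K)) : Set (Mon d m) :=
  { w | mon K w ∈ I ∧ ∀ v : Mon d m, v ≤ w → v ≠ w → mon K v ∉ I }

/-- The embedding of the variables of `P(d,m)` into those of `P(d, m + (1,…,1))`,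
identifying the vertex `j^{(i)}` with the variable `x_{i,j}`. -/
def emb : Var d m → Vtx d m := fun v => ⟨v.1, v.2.castSucc⟩

/-- The polynomial ring `P(d, m + (1,…,1))`. -/
abbrev Pp (d : ℕ) (m : Fin d → ℕ) (K : Type*) [Field K] : Type _ :=
  MvPolynomial (Vtx d m) K

/-- The Stanley-Reisner ideal of a simplicial complex on the vertex set `V`,
generated by the squarefree monomials corresponding to non-faces. -/
def SRIdeal (Δ : Set (Finset (Vtx d m))) : Ideal (Pp d m K) :=
  Ideal.span { p : Pp d m K | ∃ F : Finset (Vtx d m), F ∉ Δ ∧ p = ∏ v ∈ F, MvPolynomial.X v }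

/-- A finite set of variables is color-squarefree if it contains at most one variable of each
color; such sets correspond to the color-squarefree monomials of `P(d,m)`. -/
def CSFSet (A : Finset (Var d m)) : Prop :=
  ∀ v ∈ A, ∀ w ∈ A, v.1 = w.1 → v = w

/-- The color-squarefree monomial of `P(d, m + (1,…,1))` corresponding to `A`. -/
def monA (A : Finset (Var d m)) : Pp d m K :=
  MvPolynomial.monomial (∑ v ∈ A, Finsupp.single (emb v) 1) 1

/-- The ideal `𝔪_1^{[2]} + ⋯ + 𝔪_d^{[2]}` of `P(d, m + (1,…,1))`. -/
def brIdeal : Ideal (Pp d m K) :=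
  Ideal.span { p : Pp d m K | ∃ (i : Fin d) (j k : Fin (m i)), j < k ∧
    p = MvPolynomial.X (⟨i, j.castSucc⟩ : Vtx d m) * MvPolynomial.X (⟨i, k.castSucc⟩ : Vtx d m) }

/-- The ideal `Σ_{i=1}^d x_{i,m_i+1}·𝔪_i` of `P(d, m + (1,…,1))`. -/
def lastIdeal : Ideal (Pp d m K) :=
  Ideal.span { p : Pp d m K | ∃ (i : Fin d) (j : Fin (m i)),
    p = MvPolynomial.X (⟨i, Fin.last (m i)⟩ : Vtx d m) *
        MvPolynomial.X (⟨i, j.castSucc⟩ : Vtx d m) }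

/-- The degree of `u·∏_{i ∈ cSupp u} x_{i,m_i+1}`, for the color-squarefree monomial `u`
with support `A`. -/
def shiftDeg (A : Finset (Var d m)) : Vtx d m →₀ ℕ :=
  ∑ v ∈ A, (Finsupp.single (emb v) 1 +
    Finsupp.single (⟨v.1, Fin.last (m v.1)⟩ : Vtx d m) 1)

/-- The colon ideal `(I : u)`, where `u` is the color-squarefree monomial with support `A`. -/
def colonOf (I : Ideal (Pp d m K)) (A : Finset (Var d m)) : Ideal (Pp d m K) :=
  Submodule.colon (I : Submodule (Pp d m K) (Pp d m K)) (Ideal.span {monA K A})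

/-- The index set `[Mon_cs(P)]_k` of color-squarefree monomials of degree `k`, encoded by
their supports. -/
abbrev CSFk (d : ℕ) (m : Fin d → ℕ) (k : ℕ) : Type _ :=
  {A : Finset (Var d m) // CSFSet A ∧ A.card = k}

/-- The module `F_k = ⊕_{u ∈ [Mon_cs(P)]_k} P'/(I : u)`. -/
abbrev FmodC (I : Ideal (Pp d m K)) (k : ℕ) : Type _ :=
  ∀ A : CSFk d m k, Pp d m K ⧸ colonOf K I A.1

/-- A `P'`-linear map `P'/N₁ → P'/N₂` is graded of degree `0` with respect to the shifts
`s₁`, `s₂` (source shifted by `-s₁`, target by `-s₂`) iff it is induced by multiplication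
with a homogeneous polynomial of degree `s₁ - s₂`. -/
def GradedBetween (N₁ N₂ : Ideal (Pp d m K)) (s₁ s₂ : Vtx d m →₀ ℕ)
    (g : (Pp d m K ⧸ N₁) →ₗ[Pp d m K] Pp d m K ⧸ N₂) : Prop :=
  ∃ p : Pp d m K, (∀ μ : Vtx d m →₀ ℕ, MvPolynomial.coeff μ p ≠ 0 → μ + s₂ = s₁) ∧
    ∀ x : Pp d m K, g (Submodule.Quotient.mk x) = Submodule.Quotient.mk (p * x)

/-- The component of a linear map between direct sums (products). -/
def piComp {R : Type*} [CommRing R] {ι₁ ι₂ : Type*} [DecidableEq ι₁]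
    {M₁ : ι₁ → Type*} {M₂ : ι₂ → Type*}
    [∀ i, AddCommGroup (M₁ i)] [∀ i, Module R (M₁ i)]
    [∀ i, AddCommGroup (M₂ i)] [∀ i, Module R (M₂ i)]
    (f : (∀ i, M₁ i) →ₗ[R] ∀ i, M₂ i) (a : ι₁) (b : ι₂) : M₁ a →ₗ[R] M₂ b :=
  (LinearMap.proj b) ∘ₗ f ∘ₗ (LinearMap.single R M₁ a)

/-- The extension of the ideal `I ⊆ P(d,m)` to `P(d, m + (1,…,1))`, plus
`𝔪_1^{[2]} + ⋯ + 𝔪_d^{[2]}`; this is the ideal `I'`. -/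
def extBr (I : Ideal (PR d m K)) : Ideal (Pp d m K) :=
  Ideal.map (MvPolynomial.rename (emb : Var d m → Vtx d m)) I ⊔ brIdeal K

/-- The free module over `MvPolynomial σ K` with, for each degree `a : D`, exactly `β a`
generators in degree `a` (i.e. `⊕_a (MvPolynomial σ K)(-a)^{β a}`). -/
abbrev FMod (σ : Type*) (K : Type*) [Field K] {D : Type*} (β : D → ℕ) : Type _ :=
  (Σ a : D, Fin (β a)) →₀ MvPolynomial σ K

/-- `β : ℕ → D → ℕ` is the table of `D`-graded Betti numbers of `R/I`, where the grading on
`R = MvPolynomial σ K` is induced by the degree map `δ` on exponent vectors: there is a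
graded minimal free resolution `⋯ → F_1 → F_0 → R → R/I → 0` with
`F_k = ⊕_a R(-a)^{β k a}`.  Minimality means that all entries of the differentials lie in the
maximal ideal generated by the variables. -/
def IsMinFreeRes (σ : Type*) (K : Type*) [Field K] {D : Type*} [AddCommMonoid D]
    (δ : (σ →₀ ℕ) → D) (I : Ideal (MvPolynomial σ K)) (β : ℕ → D → ℕ) : Prop :=
  ∃ (dm : ∀ k : ℕ, FMod σ K (β (k + 1)) →ₗ[MvPolynomial σ K] FMod σ K (β k))
    (ε : FMod σ K (β 0) →ₗ[MvPolynomial σ K] MvPolynomial σ K),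
    (∀ (a : D) (i : Fin (β 0 a)) (μ : σ →₀ ℕ),
        MvPolynomial.coeff μ (ε (Finsupp.single ⟨a, i⟩ 1)) ≠ 0 → δ μ = a) ∧
    (∀ (k : ℕ) (a : D) (i : Fin (β (k + 1) a)) (b : D) (j : Fin (β k b)) (μ : σ →₀ ℕ),
        MvPolynomial.coeff μ ((dm k (Finsupp.single ⟨a, i⟩ 1)) ⟨b, j⟩) ≠ 0 → δ μ + b = a) ∧
    (∀ (k : ℕ) (a : D) (i : Fin (β (k + 1) a)) (b : D) (j : Fin (β k b)),
        MvPolynomial.coeff 0 ((dm k (Finsupp.single ⟨a, i⟩ 1)) ⟨b, j⟩) = 0) ∧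
    (LinearMap.range ε ⊔ (I : Submodule (MvPolynomial σ K) (MvPolynomial σ K)) = ⊤) ∧
    (LinearMap.range (dm 0)
      = Submodule.comap ε (I : Submodule (MvPolynomial σ K) (MvPolynomial σ K))) ∧
    (∀ k : ℕ, LinearMap.range (dm (k + 1)) = LinearMap.ker (dm k))

/-- The `ℤ^d`-degree (color degree) of an exponent vector of `P(d,m)`. -/
def degcV (μ : Var d m →₀ ℕ) : Fin d →₀ ℕ := μ.sum fun v nn => Finsupp.single v.1 nn

/-- The `ℤ^d`-degree (color degree) of an exponent vector of `P(d, m+(1,…,1))`. -/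
def degcW (μ : Vtx d m →₀ ℕ) : Fin d →₀ ℕ := μ.sum fun v nn => Finsupp.single v.1 nn

section Generic

open MvPolynomial

abbrev DD (d : ℕ) : Type := Fin d →₀ ℕ

variable {K} {σ : Type} (δ : (σ →₀ ℕ) →+ DD d)

open Classical in
/-- keep the monomials `μ` with `δ μ + b = a`. -/
def pr (b a : DD d) : MvPolynomial σ K →ₗ[K] MvPolynomial σ K :=
  (basisMonomials σ K).constr K (fun μ => if δ μ + b = a then monomial μ (1 : K) else 0)

open Classical in
lemma pr_monomial (b a : DD d) (μ : σ →₀ ℕ) (c : K) :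
    pr δ b a (monomial μ c) = if δ μ + b = a then monomial μ c else 0 := by
  have h : monomial μ c = c • (basisMonomials σ K μ) := by
    simp [coe_basisMonomials, smul_monomial]
  rw [h, map_smul, pr, Module.Basis.constr_basis]
  split_ifs <;> simp

open Classical in
lemma coeff_pr (b a : DD d) (p : MvPolynomial σ K) (μ : σ →₀ ℕ) :
    coeff μ (pr δ b a p) = if δ μ + b = a then coeff μ p else 0 := by
  induction p using MvPolynomial.induction_on' with
  | monomial ν c =>
    rw [pr_monomial]
    by_cases h : ν = μ
    · subst h; split_ifs <;> simp
    · split_ifs <;> simp [coeff_monomial, h]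
  | add p q hp hq => rw [map_add, coeff_add, coeff_add, hp, hq]; split_ifs <;> simp

lemma pr_mul (b a : DD d) (μ : σ →₀ ℕ) (c : K) (p : MvPolynomial σ K) :
    pr δ b (δ μ + a) (monomial μ c * p) = monomial μ c * pr δ b a p := by
  induction p using MvPolynomial.induction_on' with
  | monomial ν e =>
    rw [monomial_mul, pr_monomial, pr_monomial, map_add, add_assoc]
    simp only [add_right_inj]
    split_ifs <;> simp [monomial_mul]
  | add p q hp hq => rw [mul_add, map_add, hp, hq, map_add, mul_add]

lemma pr_mul0 (b a : DD d) (μ : σ →₀ ℕ) (c : K) (p : MvPolynomial σ K)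
    (h : ∀ b, a ≠ δ μ + b) :
    pr δ b a (monomial μ c * p) = 0 := by
  induction p using MvPolynomial.induction_on' with
  | monomial ν e =>
    rw [monomial_mul, pr_monomial, map_add, add_assoc, if_neg (fun e => h _ e.symm)]
  | add p q hp hq => rw [mul_add, map_add, hp, hq, add_zero]

/-- graded structure -/
structure GM (M : Type*) [AddCommGroup M] [Module (MvPolynomial σ K) M] where
  hc : DD d → M →+ M
  hmon : ∀ (μ : σ →₀ ℕ) (c : K) a x,
    hc (δ μ + a) ((monomial μ c : MvPolynomial σ K) • x) = (monomial μ c : MvPolynomial σ K) • hc a x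
  hmon0 : ∀ (μ : σ →₀ ℕ) (c : K) a x, (∀ b, a ≠ δ μ + b) →
    hc a ((monomial μ c : MvPolynomial σ K) • x) = 0
  fin : ∀ x, ∃ s : Finset (DD d), x = ∑ a ∈ s, hc a x
  idem : ∀ a x, hc a (hc a x) = hc a x
  orth : ∀ a b x, a ≠ b → hc a (hc b x) = 0

/-- the polynomial ring, graded -/
def gmR : GM (K := K) δ (MvPolynomial σ K) where
  hc a := (pr δ 0 a).toAddMonoidHom
  hmon μ c a x := pr_mul δ 0 a μ c x
  hmon0 μ c a x h := pr_mul0 δ 0 a μ c x h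
  fin x := by
    classical
    refine ⟨x.support.image δ, ?_⟩
    ext μ
    simp only [LinearMap.toAddMonoidHom_coe, coeff_sum, coeff_pr, add_zero]
    rw [Finset.sum_ite_eq]
    split_ifs with h
    · rfl
    · by_contra h'
      exact h (Finset.mem_image_of_mem _ (mem_support_iff.2 h'))
  idem a x := by
    ext μ; simp only [LinearMap.toAddMonoidHom_coe, coeff_pr]; split_ifs <;> rfl
  orth a b x h := by
    ext μ; simp only [LinearMap.toAddMonoidHom_coe, coeff_pr, add_zero]
    split_ifs with h1 h2
    · exact absurd (h1.symm.trans h2) h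
    · simp
    · simp

variable {ι : Type*} (dg : ι → DD d)

def hcF (a : DD d) : (ι →₀ MvPolynomial σ K) →+ (ι →₀ MvPolynomial σ K) :=
  Finsupp.liftAddHom (fun i => (Finsupp.singleAddHom i).comp (pr δ (dg i) a).toAddMonoidHom)

lemma hcF_single (a : DD d) (i : ι) (p : MvPolynomial σ K) :
    hcF δ dg a (Finsupp.single i p) = Finsupp.single i (pr δ (dg i) a p) := by
  simp [hcF]

lemma hcF_apply (a : DD d) (x : ι →₀ MvPolynomial σ K) (i : ι) :
    hcF δ dg a x i = pr δ (dg i) a (x i) := by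
  classical
  induction x using Finsupp.induction_linear with
  | zero => simp
  | add f g hf hg => simp [hf, hg]
  | single j p =>
    rw [hcF_single]
    by_cases h : j = i
    · subst h; simp
    · simp [h]

/-- free graded module -/
def gmF : GM (K := K) δ (ι →₀ MvPolynomial σ K) where
  hc a := hcF δ dg a
  hmon μ c a x := by ext1 i; simp [hcF_apply, pr_mul]
  hmon0 μ c a x h := by ext1 i; simp [hcF_apply, pr_mul0 δ _ a μ c _ h]
  fin x := by
    classical
    refine ⟨x.support.biUnion fun i => (x i).support.image (fun μ => δ μ + dg i), ?_⟩
    ext i μ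
    simp only [Finsupp.finsetSum_apply, hcF_apply, coeff_sum, coeff_pr]
    rw [Finset.sum_ite_eq]
    split_ifs with h
    · rfl
    · by_contra h'
      refine h (Finset.mem_biUnion.2 ⟨i, ?_, Finset.mem_image.2 ⟨μ, mem_support_iff.2 h', rfl⟩⟩)
      rw [Finsupp.mem_support_iff]
      intro h0; rw [h0] at h'; simp at h'
  idem a x := by
    ext i μ; simp only [hcF_apply, coeff_pr]; split_ifs <;> rfl
  orth a b x h := by
    ext i μ; simp only [hcF_apply, coeff_pr]
    split_ifs with h1 h2
    · exact absurd (h1.symm.trans h2) h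
    · simp
    · simp

variable {δ}
variable {M N : Type*} [AddCommGroup M] [Module (MvPolynomial σ K) M]
  [AddCommGroup N] [Module (MvPolynomial σ K) N]

lemma GM.smul (G : GM (K := K) δ M) (q : MvPolynomial σ K) (e : DD d)
    (hq : ∀ μ, coeff μ q ≠ 0 → δ μ = e) (a : DD d) (x : M) :
    G.hc (e + a) (q • x) = q • G.hc a x := by
  rw [as_sum q, Finset.sum_smul, Finset.sum_smul, map_sum]
  refine Finset.sum_congr rfl fun μ hμ => ?_
  rw [← hq μ (mem_support_iff.1 hμ), G.hmon]

lemma GM.smul0 (G : GM (K := K) δ M) (q : MvPolynomial σ K) (e : DD d)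
    (hq : ∀ μ, coeff μ q ≠ 0 → δ μ = e) (a : DD d) (ha : ∀ b, a ≠ e + b) (x : M) :
    G.hc a (q • x) = 0 := by
  rw [as_sum q, Finset.sum_smul, map_sum]
  refine Finset.sum_eq_zero fun μ hμ => ?_
  rw [G.hmon0]
  rw [hq μ (mem_support_iff.1 hμ)]; exact ha

/-- homogeneous submodule -/
def GM.Hom (G : GM (K := K) δ M) (W : Submodule (MvPolynomial σ K) M) : Prop :=
  ∀ a x, x ∈ W → G.hc a x ∈ W

lemma GM.nakayama (G : GM (K := K) δ M) (θ : MvPolynomial σ K) (e : DD d) (he : e ≠ 0)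
    (hθ : ∀ μ, coeff μ θ ≠ 0 → δ μ = e) (W Z : Submodule (MvPolynomial σ K) M)
    (hW : G.Hom W) (h : ∀ z ∈ Z, ∃ f ∈ Z, z - θ • f ∈ W) : Z ≤ W := by
  have key : ∀ n : ℕ, ∀ a : DD d, a.degree = n → ∀ z ∈ Z, G.hc a z ∈ W := by
    intro n
    induction n using Nat.strong_induction_on with
    | _ n ih =>
      intro a ha z hz
      obtain ⟨f, hf, hw⟩ := h z hz
      have h1 := hW a _ hw
      rw [map_sub] at h1
      by_cases hb : ∃ b, a = e + b
      · obtain ⟨b, rfl⟩ := hb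
        rw [G.smul θ e hθ] at h1
        have hlt : b.degree < n := by
          rw [← ha, map_add]
          have : e.degree ≠ 0 := by
            rwa [Ne, Finsupp.degree_eq_zero_iff]
          omega
        have h2 := W.smul_mem θ (ih _ hlt b rfl f hf)
        simpa using W.add_mem h1 h2
      · push Not at hb
        rw [G.smul0 θ e hθ a hb] at h1
        simpa using h1
  intro z hz
  obtain ⟨s, hs⟩ := G.fin z
  rw [hs]
  exact W.sum_mem fun a _ => key _ a rfl z hz

/-- graded maps -/
def GrMap (G : GM (K := K) δ M) (H : GM (K := K) δ N) (f : M →ₗ[MvPolynomial σ K] N) : Prop :=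
  ∀ a x, f (G.hc a x) = H.hc a (f x)

lemma grMap_free (H : GM (K := K) δ N) (f : (ι →₀ MvPolynomial σ K) →ₗ[MvPolynomial σ K] N)
    (hf : ∀ i, H.hc (dg i) (f (Finsupp.single i 1)) = f (Finsupp.single i 1)) :
    GrMap (gmF δ dg) H f := by
  intro a x
  induction x using Finsupp.induction_linear with
  | zero => simp
  | add x y hx hy => simp only [map_add, hx, hy]
  | single i p =>
    induction p using MvPolynomial.induction_on' with
    | add p q hp hq => simp only [Finsupp.single_add, map_add, hp, hq]
    | monomial μ c =>
      change f (hcF δ dg a _) = _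
      have e1 : (Finsupp.single i (monomial μ c) : ι →₀ MvPolynomial σ K)
          = (monomial μ c : MvPolynomial σ K) • Finsupp.single i 1 := by simp
      rw [hcF_single, pr_monomial]
      split_ifs with h
      · rw [e1, map_smul, ← h, H.hmon, hf]
      · rw [e1, map_smul, Finsupp.single_zero, map_zero]
        by_cases hb : ∃ b, a = δ μ + b
        · obtain ⟨b, rfl⟩ := hb
          rw [H.hmon, ← hf i, H.orth, smul_zero]
          rintro rfl; exact h rfl
        · push Not at hb
          rw [H.hmon0 _ _ _ _ hb]

/-- the condition `(*)` -/
def Star (θ : MvPolynomial σ K) (TC : Submodule (MvPolynomial σ K) N)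
    (g : M →ₗ[MvPolynomial σ K] N) : Prop :=
  ∀ f b, g b - θ • f ∈ TC → ∃ b', f - g b' ∈ TC

def Reg (θ : MvPolynomial σ K) (TC : Submodule (MvPolynomial σ K) N) : Prop :=
  ∀ f, θ • f ∈ TC → f ∈ TC

variable {L : Type*} [AddCommGroup L] [Module (MvPolynomial σ K) L]

lemma star_next (θ : MvPolynomial σ K) (TB : Submodule (MvPolynomial σ K) M)
    (TC : Submodule (MvPolynomial σ K) N) (g : M →ₗ[MvPolynomial σ K] N)
    (h : L →ₗ[MvPolynomial σ K] M) (hreg : Reg θ TC)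
    (hex : LinearMap.range h ⊔ TB = TC.comap g) : Star θ TB h := by
  intro f b hb
  have h1 : θ • f ∈ TC.comap g := by
    rw [← hex, Submodule.mem_sup]
    exact ⟨h b, ⟨b, rfl⟩, -(h b - θ • f), TB.neg_mem hb, by abel⟩
  have h2 : f ∈ TC.comap g := by
    rw [Submodule.mem_comap, map_smul] at h1
    exact hreg _ h1
  rw [← hex, Submodule.mem_sup] at h2
  obtain ⟨_, ⟨b', rfl⟩, t, ht, e⟩ := h2
  exact ⟨b', by rw [← e]; simpa using ht⟩

lemma reduce_step (θ : MvPolynomial σ K) (TB TB' : Submodule (MvPolynomial σ K) M)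
    (TC TC' : Submodule (MvPolynomial σ K) N) (g : M →ₗ[MvPolynomial σ K] N)
    (h : L →ₗ[MvPolynomial σ K] M) (hTB' : ∀ x, x ∈ TB' ↔ ∃ f, x - θ • f ∈ TB)
    (hTC' : ∀ x, x ∈ TC' ↔ ∃ f, x - θ • f ∈ TC)
    (hstar : Star θ TC g)
    (hex : LinearMap.range h ⊔ TB = TC.comap g) :
    LinearMap.range h ⊔ TB' = TC'.comap g := by
  have hle : LinearMap.range h ⊔ TB ≤ TC.comap g := hex.le
  rw [sup_le_iff] at hle
  apply le_antisymm
  · apply sup_le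
    · intro x hx
      exact (hTC' _).2 ⟨0, by simpa using hle.1 hx⟩
    · intro x hx
      obtain ⟨f, hf⟩ := (hTB' _).1 hx
      refine (hTC' _).2 ⟨g f, ?_⟩
      simpa using hle.2 hf
  · intro x hx
    obtain ⟨f, hf⟩ := (hTC' _).1 hx
    obtain ⟨b, hb⟩ := hstar f x hf
    have : x - θ • b ∈ TC.comap g := by
      rw [Submodule.mem_comap, map_sub, map_smul]
      have := TC.add_mem hf (TC.smul_mem θ hb)
      rw [smul_sub] at this
      simpa using this
    rw [← hex, Submodule.mem_sup] at this
    obtain ⟨y, hy, t, ht, e⟩ := this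
    rw [Submodule.mem_sup]
    refine ⟨y, hy, x - y, (hTB' _).2 ⟨b, ?_⟩, by abel⟩
    have : x - y - θ • b = t := by
      rw [sub_right_comm, ← e]; abel
    rwa [this]

lemma lift_step (θ : MvPolynomial σ K) (e : DD d) (he : e ≠ 0)
    (hθ : ∀ μ, coeff μ θ ≠ 0 → δ μ = e)
    (G : GM (K := K) δ M) (H : GM (K := K) δ N)
    (TB TB' : Submodule (MvPolynomial σ K) M)
    (TC TC' : Submodule (MvPolynomial σ K) N) (g : M →ₗ[MvPolynomial σ K] N)
    (h : (ι →₀ MvPolynomial σ K) →ₗ[MvPolynomial σ K] M)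
    (hTB' : ∀ x, x ∈ TB' ↔ ∃ f, x - θ • f ∈ TB)
    (hTC' : ∀ x, x ∈ TC' ↔ ∃ f, x - θ • f ∈ TC)
    (hTB : G.Hom TB) (hTC : H.Hom TC) (hg : GrMap G H g)
    (hgT : TB ≤ TC.comap g)
    (hstar : Star θ TC g) (hreg : Reg θ TC)
    (hh : ∀ i, G.hc (dg i) (h (Finsupp.single i 1)) = h (Finsupp.single i 1))
    (hex : LinearMap.range h ⊔ TB' = TC'.comap g) :
    ∃ k : (ι →₀ MvPolynomial σ K) →ₗ[MvPolynomial σ K] M,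
      (∀ i, G.hc (dg i) (k (Finsupp.single i 1)) = k (Finsupp.single i 1)) ∧
      (∀ x, ∃ y, k x = h x + θ • y) ∧
      LinearMap.range k ⊔ TB = TC.comap g := by
  have hle : LinearMap.range h ⊔ TB' ≤ TC'.comap g := hex.le
  rw [sup_le_iff] at hle
  have hz : ∀ i, ∃ y, g (h (Finsupp.single i 1) + θ • y) ∈ TC ∧
      G.hc (dg i) (h (Finsupp.single i 1) + θ • y) = h (Finsupp.single i 1) + θ • y := by
    intro i
    set z := h (Finsupp.single i 1) with hzdef
    have h1 : z ∈ TC'.comap g := hle.1 ⟨_, rfl⟩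
    obtain ⟨f, hf⟩ := (hTC' _).1 h1
    obtain ⟨b, hb⟩ := hstar f z hf
    have h2 : g (z - θ • b) ∈ TC := by
      rw [map_sub, map_smul]
      have := TC.add_mem hf (TC.smul_mem θ hb)
      rw [smul_sub] at this
      simpa using this
    have h3 := hTC (dg i) _ h2
    rw [← hg] at h3
    have h4 : ∃ y, G.hc (dg i) (z - θ • b) = z + θ • y := by
      rw [map_sub, hh]
      by_cases hb : ∃ b, dg i = e + b
      · obtain ⟨c, hc⟩ := hb
        refine ⟨- G.hc c b, ?_⟩
        rw [hc, G.smul θ e hθ, smul_neg, sub_eq_add_neg]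
      · push Not at hb
        exact ⟨0, by rw [G.smul0 θ e hθ _ hb]; simp [hzdef]⟩
    obtain ⟨y, hy⟩ := h4
    refine ⟨y, ?_, ?_⟩
    · rw [← hy]; exact h3
    · rw [← hy, G.idem]
  choose y hy1 hy2 using hz
  let k : (ι →₀ MvPolynomial σ K) →ₗ[MvPolynomial σ K] M :=
    h + θ • Finsupp.linearCombination (MvPolynomial σ K) y
  have hk : ∀ i, k (Finsupp.single i 1) = h (Finsupp.single i 1) + θ • y i := by
    intro i; simp [k]
  have hkg : ∀ i, G.hc (dg i) (k (Finsupp.single i 1)) = k (Finsupp.single i 1) := by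
    intro i; rw [hk, hy2]
  have hkh : ∀ x, ∃ y, k x = h x + θ • y :=
    fun x => ⟨Finsupp.linearCombination (MvPolynomial σ K) y x, by simp [k]⟩
  refine ⟨k, hkg, hkh, ?_⟩
  have hrange : LinearMap.range k ≤ TC.comap g := by
    rintro _ ⟨x, rfl⟩
    induction x using Finsupp.induction_linear with
    | zero => simp
    | add a b ha hb => rw [map_add]; exact Submodule.add_mem _ ha hb
    | single i p =>
      have : (Finsupp.single i p : ι →₀ MvPolynomial σ K) = p • Finsupp.single i 1 := by simp
      rw [this, map_smul, hk]
      exact Submodule.smul_mem _ _ (hy1 i)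
  apply le_antisymm (sup_le hrange hgT)
  have hkgr := grMap_free dg G k hkg
  apply G.nakayama θ e he hθ
  · intro a x hx
    obtain ⟨_, ⟨u, rfl⟩, t, ht, rfl⟩ := Submodule.mem_sup.1 hx
    rw [map_add, ← hkgr]
    exact Submodule.add_mem_sup ⟨_, rfl⟩ (hTB a t ht)
  · intro z hz
    have h1 : z ∈ TC'.comap g := (hTC' _).2 ⟨0, by simpa using hz⟩
    rw [← hex] at h1
    obtain ⟨_, ⟨u, rfl⟩, t, ht, e1⟩ := Submodule.mem_sup.1 h1
    obtain ⟨f, hf⟩ := (hTB' _).1 ht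
    obtain ⟨v, hv⟩ := hkh u
    have h2 : z - θ • (f - v) ∈ LinearMap.range k ⊔ TB := by
      have : z - θ • (f - v) = k u + (t - θ • f) := by
        rw [← e1, hv, smul_sub]; abel
      rw [this]
      exact Submodule.add_mem_sup ⟨_, rfl⟩ hf
    refine ⟨f - v, ?_, h2⟩
    have h3 := Submodule.sub_mem _ hz (sup_le hrange hgT h2)
    rw [sub_sub_cancel] at h3
    rw [Submodule.mem_comap, map_smul] at h3
    exact hreg _ h3

end Generic

section Res

open MvPolynomial

variable {K} {σ : Type} (δ : (σ →₀ ℕ) →+ DD d)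

/-- elements with all coordinates in `T` -/
def TF {ι : Type*} (T : Ideal (MvPolynomial σ K)) :
    Submodule (MvPolynomial σ K) (ι →₀ MvPolynomial σ K) where
  carrier := {x | ∀ i, x i ∈ T}
  add_mem' hx hy i := T.add_mem (hx i) (hy i)
  zero_mem' _ := T.zero_mem
  smul_mem' c _ hx i := T.mul_mem_left c (hx i)

lemma mem_TF {ι : Type*} {T : Ideal (MvPolynomial σ K)} {x : ι →₀ MvPolynomial σ K} :
    x ∈ TF T ↔ ∀ i, x i ∈ T := Iff.rfl

lemma TF_bot {ι : Type*} : (TF (⊥ : Ideal (MvPolynomial σ K)) :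
    Submodule (MvPolynomial σ K) (ι →₀ MvPolynomial σ K)) = ⊥ := by
  ext x
  rw [mem_TF, Submodule.mem_bot]
  constructor
  · intro h; ext1 i; exact h i
  · rintro rfl i; simp

lemma mem_sup_span {T : Ideal (MvPolynomial σ K)} {θ : MvPolynomial σ K} (x : MvPolynomial σ K) :
    x ∈ T ⊔ Ideal.span {θ} ↔ ∃ f, x - θ • f ∈ T := by
  rw [Submodule.mem_sup]
  constructor
  · rintro ⟨t, ht, y, hy, rfl⟩
    obtain ⟨f, rfl⟩ := Ideal.mem_span_singleton'.1 hy
    exact ⟨f, by simpa [mul_comm] using ht⟩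
  · rintro ⟨f, hf⟩
    exact ⟨_, hf, θ • f, Ideal.mem_span_singleton'.2 ⟨f, by simp [mul_comm]⟩, by simp⟩

lemma mem_TF_sup {ι : Type*} {T : Ideal (MvPolynomial σ K)} {θ : MvPolynomial σ K}
    (x : ι →₀ MvPolynomial σ K) :
    x ∈ TF (T ⊔ Ideal.span {θ}) ↔ ∃ f, x - θ • f ∈ TF T := by
  constructor
  · intro h
    have : ∀ y : MvPolynomial σ K, ∃ f, (y = 0 → f = 0) ∧
        (y ∈ T ⊔ Ideal.span {θ} → y - θ • f ∈ T) := by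
      intro y
      by_cases h0 : y = 0
      · exact ⟨0, fun _ => rfl, fun _ => by simp [h0]⟩
      · by_cases h1 : y ∈ T ⊔ Ideal.span {θ}
        · obtain ⟨f, hf⟩ := (mem_sup_span y).1 h1
          exact ⟨f, fun h => absurd h h0, fun _ => hf⟩
        · exact ⟨0, fun _ => rfl, fun h => absurd h h1⟩
    choose F hF1 hF2 using this
    refine ⟨x.mapRange F (hF1 0 rfl), fun i => ?_⟩
    simpa using hF2 _ (h i)
  · rintro ⟨f, hf⟩ i
    exact (mem_sup_span _).2 ⟨f i, by simpa using hf i⟩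

lemma hom_TF {ι : Type*} (dg : ι → DD d) {T : Ideal (MvPolynomial σ K)} (hT : (gmR δ).Hom T) :
    (gmF δ dg).Hom (TF T) := by
  classical
  intro a x hx i
  change hcF δ dg a x i ∈ T
  rw [hcF_apply]
  by_cases h : ∃ c, a = c + dg i
  · obtain ⟨c, rfl⟩ := h
    have h1 : pr δ (dg i) (c + dg i) (x i) = pr δ 0 c (x i) := by
      ext μ; simp [coeff_pr]
    rw [h1]
    exact hT c _ (hx i)
  · have h1 : pr δ (dg i) a (x i) = 0 := by
      ext μ
      rw [coeff_pr, if_neg, coeff_zero]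
      rintro rfl
      exact h ⟨_, rfl⟩
    rw [h1]; exact T.zero_mem

lemma reg_TF {ι : Type*} {T : Ideal (MvPolynomial σ K)} {θ : MvPolynomial σ K}
    (h : Reg θ T) : Reg θ (TF T : Submodule (MvPolynomial σ K) (ι →₀ MvPolynomial σ K)) :=
  fun _ hf i => h _ (hf i)

lemma TF_le {ι κ : Type*} (T : Ideal (MvPolynomial σ K))
    (g : (ι →₀ MvPolynomial σ K) →ₗ[MvPolynomial σ K] (κ →₀ MvPolynomial σ K)) :
    TF T ≤ (TF T).comap g := by
  intro x hx j
  have : g x = x.sum fun i p => p • g (Finsupp.single i 1) := by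
    conv_lhs => rw [← Finsupp.sum_single x]
    rw [Finsupp.sum, map_sum]
    refine Finset.sum_congr rfl fun i _ => ?_
    change _ = x i • g (Finsupp.single i 1)
    rw [← map_smul]; simp
  rw [this, Finsupp.sum, Finsupp.finsetSum_apply]
  refine T.sum_mem fun i _ => ?_
  exact T.mul_mem_right _ (hx i)

lemma TF_le' {ι : Type*} (T J : Ideal (MvPolynomial σ K)) (hTJ : T ≤ J)
    (g : (ι →₀ MvPolynomial σ K) →ₗ[MvPolynomial σ K] MvPolynomial σ K) :
    TF T ≤ Submodule.comap g J := by
  intro x hx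
  have : g x = x.sum fun i p => p • g (Finsupp.single i 1) := by
    conv_lhs => rw [← Finsupp.sum_single x]
    rw [Finsupp.sum, map_sum]
    refine Finset.sum_congr rfl fun i _ => ?_
    change _ = x i • g (Finsupp.single i 1)
    rw [← map_smul]; simp
  rw [Submodule.mem_comap, this, Finsupp.sum]
  refine J.sum_mem fun i _ => ?_
  exact J.mul_mem_right _ (hTJ (hx i))

/-- resolution modulo `T` -/
def RM (J T : Ideal (MvPolynomial σ K)) (β : ℕ → DD d → ℕ) : Prop :=
  ∃ (dm : ∀ k : ℕ, FMod σ K (β (k + 1)) →ₗ[MvPolynomial σ K] FMod σ K (β k))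
    (ε : FMod σ K (β 0) →ₗ[MvPolynomial σ K] MvPolynomial σ K),
    (∀ i, (gmR δ).hc i.1 (ε (Finsupp.single i 1)) = ε (Finsupp.single i 1)) ∧
    (∀ k i, (gmF δ Sigma.fst).hc i.1 (dm k (Finsupp.single i 1)) = dm k (Finsupp.single i 1)) ∧
    (∀ k i j, coeff 0 (dm k (Finsupp.single i 1) j) = 0) ∧
    (LinearMap.range ε ⊔ J = ⊤) ∧
    (LinearMap.range (dm 0) ⊔ TF T = Submodule.comap ε J) ∧
    (∀ k : ℕ, LinearMap.range (dm (k + 1)) ⊔ TF T = (TF T).comap (dm k))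

lemma gmR_iff (a : DD d) (p : MvPolynomial σ K) :
    (gmR δ).hc a p = p ↔ ∀ μ, coeff μ p ≠ 0 → δ μ = a := by
  classical
  change pr δ 0 a p = p ↔ _
  rw [MvPolynomial.ext_iff]
  refine forall_congr' fun μ => ?_
  rw [coeff_pr, add_zero]
  split_ifs with h
  · simp [h]
  · constructor
    · intro h1 h2; exact absurd h1.symm h2
    · intro h1; by_contra h2; exact h (h1 (Ne.symm h2))

lemma gmF_iff {ι : Type*} (dg : ι → DD d) (a : DD d) (x : ι →₀ MvPolynomial σ K) :
    (gmF δ dg).hc a x = x ↔ ∀ i μ, coeff μ (x i) ≠ 0 → δ μ + dg i = a := by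
  classical
  change hcF δ dg a x = x ↔ _
  rw [Finsupp.ext_iff]
  refine forall_congr' fun i => ?_
  rw [hcF_apply, MvPolynomial.ext_iff]
  refine forall_congr' fun μ => ?_
  rw [coeff_pr]
  split_ifs with h
  · simp [h]
  · constructor
    · intro h1 h2; exact absurd h1.symm h2
    · intro h1; by_contra h2; exact h (h1 (Ne.symm h2))

lemma RM_bot (J : Ideal (MvPolynomial σ K)) (β : ℕ → DD d → ℕ) :
    RM δ J ⊥ β ↔ IsMinFreeRes σ K (fun μ => δ μ) J β := by
  unfold RM IsMinFreeRes
  refine exists_congr fun dm => exists_congr fun ε => ?_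
  simp only [TF_bot, sup_bot_eq, gmR_iff, gmF_iff, Sigma.forall]
  rfl

variable {δ}

lemma RM_down (θ : MvPolynomial σ K) {J T : Ideal (MvPolynomial σ K)} (β : ℕ → DD d → ℕ)
    (hrT : Reg θ T) (hrJ : Reg θ J) (h : RM δ J T β) :
    RM δ (J ⊔ Ideal.span {θ}) (T ⊔ Ideal.span {θ}) β := by
  obtain ⟨dm, ε, h1, h2, h3, h4, h5, h6⟩ := h
  refine ⟨dm, ε, h1, h2, h3, ?_, ?_, ?_⟩
  · rw [← sup_assoc, h4, top_sup_eq]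
  · refine reduce_step θ _ _ _ _ ε (dm 0) mem_TF_sup mem_sup_span ?_ h5
    intro f b _
    have : f ∈ LinearMap.range ε ⊔ J := by rw [h4]; trivial
    obtain ⟨_, ⟨b', rfl⟩, t, ht, e⟩ := Submodule.mem_sup.1 this
    exact ⟨b', by rw [← e]; simpa using ht⟩
  · intro k
    refine reduce_step θ _ _ _ _ (dm k) (dm (k+1)) mem_TF_sup mem_TF_sup ?_ (h6 k)
    cases k with
    | zero => exact star_next θ _ _ ε (dm 0) hrJ h5
    | succ k => exact star_next θ _ _ (dm k) (dm (k+1)) (reg_TF hrT) (h6 k)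

lemma RM_up (θ : MvPolynomial σ K) (e : DD d) (he : e ≠ 0)
    (hθ : ∀ μ, coeff μ θ ≠ 0 → δ μ = e)
    {J T : Ideal (MvPolynomial σ K)} (β : ℕ → DD d → ℕ) (hTJ : T ≤ J)
    (hT : (gmR δ).Hom T) (hJ : (gmR δ).Hom J)
    (hrT : Reg θ T) (hrJ : Reg θ J)
    (h : RM δ (J ⊔ Ideal.span {θ}) (T ⊔ Ideal.span {θ}) β) : RM δ J T β := by
  obtain ⟨dm, ε, h1, h2, h3, h4, h5, h6⟩ := h
  have hθ0 : coeff 0 θ = 0 := by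
    by_contra h0
    exact he ((hθ 0 h0).symm.trans (map_zero δ))
  have gε := grMap_free Sigma.fst (gmR δ) ε h1
  have h4' : LinearMap.range ε ⊔ J = ⊤ := by
    rw [eq_top_iff]
    refine (gmR δ).nakayama θ e he hθ _ _ ?_ ?_
    · intro a x hx
      obtain ⟨_, ⟨u, rfl⟩, t, ht, rfl⟩ := Submodule.mem_sup.1 hx
      rw [map_add, ← gε]
      exact Submodule.add_mem_sup ⟨_, rfl⟩ (hJ a t ht)
    · intro z _
      have : z ∈ LinearMap.range ε ⊔ (J ⊔ Ideal.span {θ}) := by rw [h4]; trivial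
      obtain ⟨y, hy, t, ht, e⟩ := Submodule.mem_sup.1 this
      obtain ⟨f, hf⟩ := (mem_sup_span _).1 ht
      refine ⟨f, trivial, ?_⟩
      rw [← e, add_sub_assoc]
      exact Submodule.add_mem_sup hy hf
  let Inv : ∀ k, (FMod σ K (β (k + 1)) →ₗ[MvPolynomial σ K] FMod σ K (β k)) → Prop :=
    fun k g => (∀ i, (gmF δ Sigma.fst).hc i.1 (g (Finsupp.single i 1)) = g (Finsupp.single i 1)) ∧
      (∀ x, ∃ y, g x = dm k x + θ • y) ∧ Star θ (TF T) g
  obtain ⟨⟨g0, hg0⟩, hg0e⟩ : ∃ g : {g // Inv 0 g}, LinearMap.range g.1 ⊔ TF T = Submodule.comap ε J := by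
    obtain ⟨k, hk1, hk2, hk3⟩ := lift_step Sigma.fst θ e he hθ (gmF δ Sigma.fst) (gmR δ) (TF T) _ J _
      ε (dm 0) mem_TF_sup mem_sup_span (hom_TF δ _ hT) hJ gε (TF_le' T J hTJ ε)
      (by
        intro f b _
        have : f ∈ LinearMap.range ε ⊔ J := by rw [h4']; trivial
        obtain ⟨_, ⟨b', rfl⟩, t, ht, e⟩ := Submodule.mem_sup.1 this
        exact ⟨b', by rw [← e]; simpa using ht⟩) hrJ (h2 0) h5
    exact ⟨⟨k, hk1, hk2, star_next θ _ _ ε k hrJ hk3⟩, hk3⟩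
  have step : ∀ k (g : {g // Inv k g}), ∃ h : {h // Inv (k+1) h},
      LinearMap.range h.1 ⊔ TF T = (TF T).comap g.1 := by
    rintro k ⟨g, hg1, hg2, hg3⟩
    have hex : LinearMap.range (dm (k+1)) ⊔ TF (T ⊔ Ideal.span {θ}) =
        (TF (T ⊔ Ideal.span {θ})).comap g := by
      rw [h6 k]
      ext x
      obtain ⟨y, hy⟩ := hg2 x
      have hy' : θ • y ∈ TF (T ⊔ Ideal.span {θ}) := (mem_TF_sup _).2 ⟨y, by simp⟩
      rw [Submodule.mem_comap, Submodule.mem_comap, hy]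
      exact (Submodule.add_mem_iff_left _ hy').symm
    obtain ⟨k', hk1, hk2, hk3⟩ := lift_step Sigma.fst θ e he hθ (gmF δ Sigma.fst) (gmF δ Sigma.fst)
      (TF T) _ (TF T) _
      g (dm (k+1)) mem_TF_sup mem_TF_sup (hom_TF δ _ hT) (hom_TF δ _ hT)
      (grMap_free Sigma.fst _ g hg1) (TF_le T g) hg3 (reg_TF hrT) (h2 (k+1)) hex
    exact ⟨⟨k', hk1, hk2, star_next θ _ _ g k' (reg_TF hrT) hk3⟩, hk3⟩
  choose nxt hnxt using step
  let sq : ∀ k, {g // Inv k g} := fun k => Nat.rec ⟨g0, hg0⟩ (fun k g => nxt k g) k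
  refine ⟨fun k => (sq k).1, ε, h1, fun k => (sq k).2.1, ?_, h4', hg0e, fun k => hnxt k (sq k)⟩
  intro k i j
  obtain ⟨y, hy⟩ := (sq k).2.2.1 (Finsupp.single i 1)
  rw [hy, Finsupp.add_apply, coeff_add, h3, zero_add, Finsupp.smul_apply, smul_eq_mul,
    ← constantCoeff_eq, map_mul, constantCoeff_eq, hθ0, zero_mul]

lemma hom_span (S : Set (MvPolynomial σ K))
    (hS : ∀ s ∈ S, ∃ e, ∀ μ, coeff μ s ≠ 0 → δ μ = e) : (gmR δ).Hom (Ideal.span S) := by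
  intro a x hx
  induction hx using Submodule.span_induction generalizing a with
  | zero => simp
  | add x y _ _ hx hy => rw [map_add]; exact Submodule.add_mem _ (hx a) (hy a)
  | smul c x _ hx =>
    induction c using MvPolynomial.induction_on' with
    | add p q hp hq => rw [add_smul, map_add]; exact Submodule.add_mem _ hp hq
    | monomial μ c =>
      by_cases hb : ∃ b, a = δ μ + b
      · obtain ⟨b, rfl⟩ := hb
        rw [(gmR δ).hmon]
        exact Submodule.smul_mem _ _ (hx b)
      · push Not at hb
        rw [(gmR δ).hmon0 _ _ _ _ hb]
        exact Submodule.zero_mem _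
  | mem x hx =>
    obtain ⟨e, he⟩ := hS x hx
    by_cases h : a = e
    · subst h
      rw [(gmR_iff δ a x).2 he]
      exact Submodule.subset_span hx
    · rw [← (gmR_iff δ e x).2 he, (gmR δ).orth _ _ _ h]
      exact Submodule.zero_mem _

end Res

section Transfer

open MvPolynomial

variable {K} {σ τ : Type} {δ : (σ →₀ ℕ) →+ DD d} {δ' : (τ →₀ ℕ) →+ DD d}

lemma comm_gen {ι N N' : Type*} [AddCommGroup N] [Module (MvPolynomial σ K) N]
    [AddCommGroup N'] [Module (MvPolynomial τ K) N']
    (π : MvPolynomial τ K →ₐ[K] MvPolynomial σ K) (q : N' →+ N)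
    (hq : ∀ (p : MvPolynomial τ K) x, q (p • x) = π p • q x)
    (f' : (ι →₀ MvPolynomial τ K) →ₗ[MvPolynomial τ K] N')
    (f : (ι →₀ MvPolynomial σ K) →ₗ[MvPolynomial σ K] N)
    (h : ∀ i, q (f' (Finsupp.single i 1)) = f (Finsupp.single i 1)) (x) :
    q (f' x) = f (Finsupp.mapRange.addMonoidHom (π : MvPolynomial τ K →+ MvPolynomial σ K) x) := by
  induction x using Finsupp.induction_linear with
  | zero => simp
  | add x y hx hy => simp only [map_add, hx, hy]
  | single i p =>
    have e1 : (Finsupp.single i p : ι →₀ MvPolynomial τ K) = p • Finsupp.single i 1 := by simp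
    have e2 : (Finsupp.single i (π p) : ι →₀ MvPolynomial σ K) = π p • Finsupp.single i 1 := by simp
    rw [e1, map_smul, hq, h, ← map_smul, ← e1, ← e2]
    simp

lemma exact_iff {A B C A' B' C' : Type*}
    [AddCommGroup A] [Module (MvPolynomial σ K) A]
    [AddCommGroup B] [Module (MvPolynomial σ K) B]
    [AddCommGroup C] [Module (MvPolynomial σ K) C]
    [AddCommGroup A'] [Module (MvPolynomial τ K) A']
    [AddCommGroup B'] [Module (MvPolynomial τ K) B']
    [AddCommGroup C'] [Module (MvPolynomial τ K) C']
    (qA : A' →+ A) (qB : B' →+ B) (qC : C' →+ C)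
    (hA : Function.Surjective qA) (hB : Function.Surjective qB)
    (TB' : Submodule (MvPolynomial τ K) B') (TC' : Submodule (MvPolynomial τ K) C')
    (TB : Submodule (MvPolynomial σ K) B) (TC : Submodule (MvPolynomial σ K) C)
    (hTB : ∀ x, x ∈ TB' ↔ qB x ∈ TB) (hTC : ∀ x, x ∈ TC' ↔ qC x ∈ TC)
    (h' : A' →ₗ[MvPolynomial τ K] B') (g' : B' →ₗ[MvPolynomial τ K] C')
    (h : A →ₗ[MvPolynomial σ K] B) (g : B →ₗ[MvPolynomial σ K] C)
    (ch : ∀ x, qB (h' x) = h (qA x)) (cg : ∀ x, qC (g' x) = g (qB x)) :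
    LinearMap.range h' ⊔ TB' = TC'.comap g' ↔ LinearMap.range h ⊔ TB = TC.comap g := by
  have e1 : ∀ x, x ∈ LinearMap.range h' ⊔ TB' ↔ qB x ∈ LinearMap.range h ⊔ TB := by
    intro x
    rw [Submodule.mem_sup, Submodule.mem_sup]
    constructor
    · rintro ⟨_, ⟨a, rfl⟩, t, ht, rfl⟩
      exact ⟨h (qA a), ⟨_, rfl⟩, qB t, (hTB t).1 ht, by rw [map_add, ch]⟩
    · rintro ⟨_, ⟨a, rfl⟩, t, ht, e⟩
      obtain ⟨a', rfl⟩ := hA a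
      refine ⟨h' a', ⟨_, rfl⟩, x - h' a', (hTB _).2 ?_, by abel⟩
      rw [map_sub, ch, ← e]
      simpa using ht
  have e2 : ∀ x, x ∈ TC'.comap g' ↔ qB x ∈ TC.comap g := by
    intro x
    rw [Submodule.mem_comap, Submodule.mem_comap, hTC, cg]
  constructor
  · intro hh
    ext y
    obtain ⟨x, rfl⟩ := hB y
    rw [← e1, ← e2, hh]
  · intro hh
    ext x
    rw [e1, e2, hh]

/-- push a hom along a ring map -/
def push {ι κ : Type*} (π : MvPolynomial τ K →ₐ[K] MvPolynomial σ K)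
    (f : (ι →₀ MvPolynomial τ K) →ₗ[MvPolynomial τ K] (κ →₀ MvPolynomial τ K)) :
    (ι →₀ MvPolynomial σ K) →ₗ[MvPolynomial σ K] (κ →₀ MvPolynomial σ K) :=
  Finsupp.linearCombination _ (fun i =>
    Finsupp.mapRange.addMonoidHom (π : MvPolynomial τ K →+ MvPolynomial σ K) (f (Finsupp.single i 1)))

lemma push_apply {ι κ : Type*} (π : MvPolynomial τ K →ₐ[K] MvPolynomial σ K)
    (f : (ι →₀ MvPolynomial τ K) →ₗ[MvPolynomial τ K] (κ →₀ MvPolynomial τ K)) (i : ι) (j : κ) :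
    push π f (Finsupp.single i 1) j = π (f (Finsupp.single i 1) j) := by
  simp [push]

def push1 {ι : Type*} (π : MvPolynomial τ K →ₐ[K] MvPolynomial σ K)
    (f : (ι →₀ MvPolynomial τ K) →ₗ[MvPolynomial τ K] MvPolynomial τ K) :
    (ι →₀ MvPolynomial σ K) →ₗ[MvPolynomial σ K] MvPolynomial σ K :=
  Finsupp.linearCombination _ (fun i => π (f (Finsupp.single i 1)))

lemma push1_apply {ι : Type*} (π : MvPolynomial τ K →ₐ[K] MvPolynomial σ K)
    (f : (ι →₀ MvPolynomial τ K) →ₗ[MvPolynomial τ K] MvPolynomial τ K) (i : ι) :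
    push1 π f (Finsupp.single i 1) = π (f (Finsupp.single i 1)) := by
  simp [push1]

/-- homogeneous ring maps -/
def HomogMap (δ' : (τ →₀ ℕ) →+ DD d) (δ : (σ →₀ ℕ) →+ DD d)
    (π : MvPolynomial τ K →ₐ[K] MvPolynomial σ K) : Prop :=
  ∀ (p : MvPolynomial τ K) (a : DD d), (∀ μ, coeff μ p ≠ 0 → δ' μ = a) →
    ∀ μ, coeff μ (π p) ≠ 0 → δ μ = a

lemma homogF {ι : Type*} (dg : ι → DD d) {π : MvPolynomial τ K →ₐ[K] MvPolynomial σ K}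
    (hπ : HomogMap δ' δ π) (x' : ι →₀ MvPolynomial τ K) (x : ι →₀ MvPolynomial σ K)
    (hx : ∀ i, x i = π (x' i)) (a : DD d) (h : (gmF δ' dg).hc a x' = x') :
    (gmF δ dg).hc a x = x := by
  rw [gmF_iff] at h ⊢
  intro i μ hμ
  rw [hx] at hμ
  by_cases hb : ∃ b, b + dg i = a
  · obtain ⟨b, rfl⟩ := hb
    rw [hπ (x' i) b (fun ν hν => add_right_cancel (h i ν hν)) μ hμ]
  · exfalso
    have : x' i = 0 := by
      ext ν
      by_contra h0
      exact hb ⟨_, h i ν h0⟩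
    rw [this] at hμ
    simp at hμ

lemma transfer_core
    (π : MvPolynomial τ K →ₐ[K] MvPolynomial σ K) (hsurj : Function.Surjective π)
    (T J' : Ideal (MvPolynomial τ K)) (J : Ideal (MvPolynomial σ K))
    (hT : ∀ p, p ∈ T ↔ π p = 0) (hJ : ∀ p, p ∈ J' ↔ π p ∈ J)
    (β : ℕ → DD d → ℕ)
    (dm' : ∀ k : ℕ, FMod τ K (β (k + 1)) →ₗ[MvPolynomial τ K] FMod τ K (β k))
    (ε' : FMod τ K (β 0) →ₗ[MvPolynomial τ K] MvPolynomial τ K)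
    (dm : ∀ k : ℕ, FMod σ K (β (k + 1)) →ₗ[MvPolynomial σ K] FMod σ K (β k))
    (ε : FMod σ K (β 0) →ₗ[MvPolynomial σ K] MvPolynomial σ K)
    (hd : ∀ k i j, dm k (Finsupp.single i 1) j = π (dm' k (Finsupp.single i 1) j))
    (he : ∀ i, ε (Finsupp.single i 1) = π (ε' (Finsupp.single i 1))) :
    ((LinearMap.range ε' ⊔ J' = ⊤) ∧
    (LinearMap.range (dm' 0) ⊔ TF T = Submodule.comap ε' J') ∧
    (∀ k : ℕ, LinearMap.range (dm' (k + 1)) ⊔ TF T = (TF T).comap (dm' k))) ↔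
    ((LinearMap.range ε ⊔ J = ⊤) ∧
    (LinearMap.range (dm 0) ⊔ TF ⊥ = Submodule.comap ε J) ∧
    (∀ k : ℕ, LinearMap.range (dm (k + 1)) ⊔ TF ⊥ = (TF ⊥).comap (dm k))) := by
  let q : ∀ k, FMod τ K (β k) →+ FMod σ K (β k) := fun k =>
    Finsupp.mapRange.addMonoidHom (π : MvPolynomial τ K →+ MvPolynomial σ K)
  have hq : ∀ k x i, q k x i = π (x i) := fun k x i => rfl
  have hqs : ∀ k, Function.Surjective (q k) := fun k => by
    intro x
    have := Finsupp.mapRange_surjective (α := Σ a, Fin (β k a)) π (map_zero π) hsurj x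
    exact this
  have cd : ∀ k x, q k (dm' k x) = dm k (q (k+1) x) := fun k x =>
    comm_gen π (q k) (fun p x => by ext1 i; simp [hq]) (dm' k) (dm k)
      (fun i => by ext1 j; rw [hd, hq]) x
  have ce : ∀ x, (π : MvPolynomial τ K →+ MvPolynomial σ K) (ε' x) = ε (q 0 x) := fun x =>
    comm_gen π (π : MvPolynomial τ K →+ MvPolynomial σ K) (fun p x => by simp) ε' ε
      (fun i => (he i).symm) x
  have hTF : ∀ k (x : FMod τ K (β k)), x ∈ TF T ↔ q k x ∈ TF ⊥ := by
    intro k x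
    rw [mem_TF, mem_TF]
    exact forall_congr' fun i => by rw [hT, hq, Ideal.mem_bot]
  refine and_congr ?_ (and_congr ?_ (forall_congr' fun k => ?_))
  · have := exact_iff (q 0) (π : MvPolynomial τ K →+ MvPolynomial σ K) (0 : PUnit →+ PUnit)
      (A := FMod σ K (β 0)) (A' := FMod τ K (β 0)) (hqs 0) hsurj J' (⊤ : Submodule _ PUnit) J
      (⊤ : Submodule _ PUnit) hJ (by simp) ε' 0 ε 0 ce (by simp)
    simpa using this
  · exact exact_iff (q 1) (q 0) (π : MvPolynomial τ K →+ MvPolynomial σ K) (hqs 1) (hqs 0)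
      _ _ _ _ (hTF 0) hJ _ _ _ _ (cd 0) ce
  · exact exact_iff (q (k+2)) (q (k+1)) (q k) (hqs _) (hqs _)
      _ _ _ _ (hTF _) (hTF _) _ _ _ _ (cd (k+1)) (cd k)

lemma transfer
    (π : MvPolynomial τ K →ₐ[K] MvPolynomial σ K) (s : MvPolynomial σ K →ₐ[K] MvPolynomial τ K)
    (hs : ∀ p, π (s p) = p)
    (hπh : HomogMap δ' δ π) (hsh : HomogMap δ δ' s)
    (hπ0 : ∀ p, coeff 0 (π p) = coeff 0 p)
    (T J' : Ideal (MvPolynomial τ K)) (J : Ideal (MvPolynomial σ K))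
    (hT : ∀ p, p ∈ T ↔ π p = 0) (hJ : ∀ p, p ∈ J' ↔ π p ∈ J)
    (β : ℕ → DD d → ℕ) : RM δ' J' T β ↔ RM δ J ⊥ β := by
  have hsurj : Function.Surjective π := fun p => ⟨s p, hs p⟩
  constructor
  · rintro ⟨dm, ε, h1, h2, h3, h4⟩
    refine ⟨fun k => push π (dm k), push1 π ε, ?_, ?_, ?_, ?_⟩
    · intro i
      rw [push1_apply, gmR_iff]
      exact hπh _ _ ((gmR_iff _ _ _).1 (h1 i))
    · intro k i
      exact homogF Sigma.fst hπh _ _ (push_apply π (dm k) i) _ (h2 k i)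
    · intro k i j
      rw [push_apply, hπ0, h3]
    · exact (transfer_core π hsurj T J' J hT hJ β dm ε (fun k => push π (dm k)) (push1 π ε)
        (fun k i j => push_apply π (dm k) i j) (push1_apply π ε)).1 h4
  · rintro ⟨dm, ε, h1, h2, h3, h4⟩
    refine ⟨fun k => push s (dm k), push1 s ε, ?_, ?_, ?_, ?_⟩
    · intro i
      rw [push1_apply, gmR_iff]
      exact hsh _ _ ((gmR_iff _ _ _).1 (h1 i))
    · intro k i
      exact homogF Sigma.fst hsh _ _ (push_apply s (dm k) i) _ (h2 k i)
    · intro k i j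
      rw [push_apply, ← hπ0, hs, h3]
    · exact (transfer_core π hsurj T J' J hT hJ β (fun k => push s (dm k)) (push1 s ε) dm ε
        (fun k i j => by rw [push_apply, hs]) (fun i => by rw [push1_apply, hs])).2 h4

end Transfer

section Comb

open MvPolynomial

abbrev wV (v : Var d m) : DD d := Finsupp.single v.1 1
abbrev wW (v : Vtx d m) : DD d := Finsupp.single v.1 1

lemma degcV_eq : (degcV : (Var d m →₀ ℕ) → DD d) = fun μ => Finsupp.weight wV μ := by
  funext μ
  simp [degcV, Finsupp.weight_apply]

lemma degcW_eq : (degcW : (Vtx d m →₀ ℕ) → DD d) = fun μ => Finsupp.weight wW μ := by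
  funext μ
  simp [degcW, Finsupp.weight_apply]

lemma homogMap_of {σ τ : Type} (w' : τ → DD d) (w : σ → DD d)
    (π : MvPolynomial τ K →ₐ[K] MvPolynomial σ K)
    (h : ∀ v, IsWeightedHomogeneous w (π (X v)) (w' v)) :
    HomogMap (Finsupp.weight w') (Finsupp.weight w) π := by
  intro p a hp
  change IsWeightedHomogeneous w (π p) a
  rw [as_sum p, map_sum]
  refine IsWeightedHomogeneous.sum _ _ _ fun μ hμ => ?_
  rw [← hp μ (mem_support_iff.1 hμ), aeval_unique π, aeval_monomial, algebraMap_eq,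
    Finsupp.weight_apply]
  rw [← zero_add (Finsupp.sum _ _)]
  refine IsWeightedHomogeneous.mul (isWeightedHomogeneous_C _ _) ?_
  exact IsWeightedHomogeneous.prod _ _ _ fun v _ => (h v).pow _

/-- the linear form `θ_i` -/
def th (m : Fin d → ℕ) (i : Fin d) : Pp d m K :=
  X (⟨i, Fin.last (m i)⟩ : Vtx d m) - ∑ j : Fin (m i), X (⟨i, j.castSucc⟩ : Vtx d m)

def Ts (m : Fin d → ℕ) (s : Set (Fin d)) : Ideal (Pp d m K) := Ideal.span (th K m '' s)

open Classical in
def phi (m : Fin d → ℕ) (s : Set (Fin d)) : Pp d m K →ₐ[K] Pp d m K :=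
  aeval (fun v : Vtx d m => if v.1 ∈ s ∧ v.2 = Fin.last (m v.1) then
    ∑ j : Fin (m v.1), X (⟨v.1, j.castSucc⟩ : Vtx d m) else X v)

lemma phi_cast (s : Set (Fin d)) (i : Fin d) (j : Fin (m i)) :
    phi K m s (X (⟨i, j.castSucc⟩ : Vtx d m)) = X (⟨i, j.castSucc⟩ : Vtx d m) := by
  rw [phi, aeval_X, if_neg]
  rintro ⟨_, h⟩
  exact (Fin.castSucc_lt_last j).ne h

lemma phi_last (s : Set (Fin d)) (i : Fin d) (hi : i ∈ s) :
    phi K m s (X (⟨i, Fin.last (m i)⟩ : Vtx d m)) =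
      ∑ j : Fin (m i), X (⟨i, j.castSucc⟩ : Vtx d m) := by
  rw [phi, aeval_X, if_pos ⟨hi, rfl⟩]

lemma phi_last' (s : Set (Fin d)) (i : Fin d) (hi : i ∉ s) :
    phi K m s (X (⟨i, Fin.last (m i)⟩ : Vtx d m)) = X (⟨i, Fin.last (m i)⟩ : Vtx d m) := by
  rw [phi, aeval_X, if_neg (fun h => hi h.1)]

lemma phi_th (s : Set (Fin d)) (i : Fin d) (hi : i ∈ s) : phi K m s (th K m i) = 0 := by
  rw [th, map_sub, map_sum, phi_last K s i hi]
  simp only [phi_cast]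
  rw [sub_self]

lemma phi_th' (s : Set (Fin d)) (i : Fin d) (hi : i ∉ s) : phi K m s (th K m i) = th K m i := by
  rw [th, map_sub, map_sum, phi_last' K s i hi]
  simp only [phi_cast]

lemma phi_sub (s : Set (Fin d)) (p : Pp d m K) : p - phi K m s p ∈ Ts K m s := by
  rw [← Ideal.Quotient.mk_eq_mk_iff_sub_mem]
  have : (Ideal.Quotient.mkₐ K (Ts K m s)) =
      (Ideal.Quotient.mkₐ K (Ts K m s)).comp (phi K m s) := by
    apply MvPolynomial.algHom_ext
    rintro ⟨i, k⟩
    refine Fin.lastCases ?_ (fun j => ?_) k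
    · by_cases hi : i ∈ s
      · rw [AlgHom.comp_apply, phi_last K s i hi]
        change Ideal.Quotient.mk _ _ = Ideal.Quotient.mk _ _
        rw [Ideal.Quotient.mk_eq_mk_iff_sub_mem]
        exact Ideal.subset_span ⟨i, hi, rfl⟩
      · rw [AlgHom.comp_apply, phi_last' K s i hi]
    · rw [AlgHom.comp_apply, phi_cast]
  exact DFunLike.congr_fun this p

lemma mem_Ts (s : Set (Fin d)) (p : Pp d m K) : p ∈ Ts K m s ↔ phi K m s p = 0 := by
  constructor
  · intro h
    have : Ts K m s ≤ RingHom.ker (phi K m s) := by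
      rw [Ts, Ideal.span_le]
      rintro _ ⟨i, hi, rfl⟩
      exact phi_th K s i hi
    exact this h
  · intro h
    have := phi_sub K s p
    rwa [h, sub_zero] at this

lemma th_ne (i : Fin d) : th K m i ≠ 0 := by
  classical
  intro h
  have : coeff (Finsupp.single (⟨i, Fin.last (m i)⟩ : Vtx d m) 1) (th K m i) = 1 := by
    rw [th, coeff_sub, coeff_sum, Finset.sum_eq_zero]
    · simp
    · intro j _
      rw [coeff_X, if_neg]
      intro h
      have := Finsupp.single_left_injective one_ne_zero h
      have h2 := congrArg (fun v : Vtx d m => (v.2 : ℕ)) this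
      simp at h2
      have := j.2
      omega
  rw [h] at this
  simp at this

lemma reg_Ts (s : Set (Fin d)) (i : Fin d) (hi : i ∉ s) : Reg (th K m i) (Ts K m s) := by
  intro f hf
  rw [mem_Ts, smul_eq_mul, map_mul, phi_th' K s i hi] at hf
  rw [mem_Ts]
  exact (mul_eq_zero.1 hf).resolve_left (th_ne K i)

/-- exponents of the generators of the degenerate monomial ideal -/
def GG (S : Set (Mon d m)) (s : Set (Fin d)) : Set (Vtx d m →₀ ℕ) :=
  {g | (∃ u ∈ S, g = Finsupp.mapDomain emb u) ∨
    (∃ (i : Fin d) (j k : Fin (m i)), (j ≠ k ∨ i ∈ s) ∧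
      g = Finsupp.single ⟨i, j.castSucc⟩ 1 + Finsupp.single ⟨i, k.castSucc⟩ 1) ∨
    (∃ (i : Fin d) (j : Fin (m i)), i ∉ s ∧
      g = Finsupp.single ⟨i, Fin.last (m i)⟩ 1 + Finsupp.single ⟨i, j.castSucc⟩ 1)}

def Js (S : Set (Mon d m)) (s : Set (Fin d)) : Ideal (Pp d m K) :=
  Ideal.span ((fun g => monomial g (1 : K)) '' GG S s)

lemma emb_inj : Function.Injective (emb : Var d m → Vtx d m) := by
  rintro ⟨i, j⟩ ⟨i', j'⟩ h
  simp only [emb, Sigma.mk.injEq] at h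
  obtain ⟨rfl, h⟩ := h
  have := Fin.castSucc_injective _ (eq_of_heq h)
  rw [this]

lemma emb_ne_last (i : Fin d) (v : Var d m) : emb v ≠ (⟨i, Fin.last (m i)⟩ : Vtx d m) := by
  obtain ⟨i', j⟩ := v
  intro h
  simp only [emb, Sigma.mk.injEq] at h
  obtain ⟨rfl, h⟩ := h
  exact (Fin.castSucc_lt_last j).ne (eq_of_heq h)

lemma map_last (u : Mon d m) (i : Fin d) :
    Finsupp.mapDomain emb u (⟨i, Fin.last (m i)⟩ : Vtx d m) = 0 := by
  apply Finsupp.mapDomain_of_notMem_range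
  rintro ⟨v, hv⟩
  exact emb_ne_last i v hv

lemma cast_ne_last (i i' : Fin d) (j : Fin (m i)) :
    (⟨i, j.castSucc⟩ : Vtx d m) ≠ ⟨i', Fin.last (m i')⟩ := emb_ne_last i' ⟨i, j⟩

lemma cast_inj {i : Fin d} {j k : Fin (m i)}
    (h : (⟨i, j.castSucc⟩ : Vtx d m) = ⟨i, k.castSucc⟩) : j = k := by
  have := emb_inj (a₁ := (⟨i, j⟩ : Var d m)) (a₂ := ⟨i, k⟩) h
  simpa using this

lemma GG_le_one (S : Set (Mon d m)) (hS : ∀ u ∈ S, ColorSquarefree u) (s : Set (Fin d))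
    (v : Vtx d m) (hv : v.1 ∉ s) (g : Vtx d m →₀ ℕ) (hg : g ∈ GG S s) : g v ≤ 1 := by
  classical
  rcases hg with ⟨u, hu, rfl⟩ | ⟨i, j, k, hjk, rfl⟩ | ⟨i, j, hi, rfl⟩
  · obtain ⟨i, k⟩ := v
    refine Fin.lastCases ?_ (fun j => ?_) k
    · rw [map_last]; exact Nat.zero_le _
    · have := Finsupp.mapDomain_apply emb_inj u (⟨i, j⟩ : Var d m)
      change Finsupp.mapDomain emb u (emb (⟨i, j⟩ : Var d m)) ≤ 1
      rw [this]
      exact (Finset.single_le_sum (f := fun j => u ⟨i, j⟩) (fun _ _ => Nat.zero_le _)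
        (Finset.mem_univ j)).trans (hS u hu i)
  · rw [Finsupp.add_apply, Finsupp.single_apply, Finsupp.single_apply]
    split_ifs with h1 h2
    · exfalso
      subst h1
      have := cast_inj h2
      subst this
      rcases hjk with h | h
      · exact h rfl
      · exact hv h
    all_goals omega
  · rw [Finsupp.add_apply, Finsupp.single_apply, Finsupp.single_apply]
    split_ifs with h1 h2
    · exfalso
      subst h1
      exact cast_ne_last _ _ _ h2
    all_goals omega

lemma GG_last (S : Set (Mon d m)) (s : Set (Fin d))
    (i : Fin d) (g : Vtx d m →₀ ℕ) (hg : g ∈ GG S s) (h : g ⟨i, Fin.last (m i)⟩ ≠ 0) :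
    ∃ j : Fin (m i), g ⟨i, j.castSucc⟩ ≠ 0 := by
  classical
  rcases hg with ⟨u, hu, rfl⟩ | ⟨i', j, k, hjk, rfl⟩ | ⟨i', j, hi, rfl⟩
  · exact absurd (map_last u i) h
  · exfalso
    apply h
    rw [Finsupp.add_apply, Finsupp.single_eq_of_ne' (cast_ne_last _ _ _),
      Finsupp.single_eq_of_ne' (cast_ne_last _ _ _), add_zero]
  · rw [Finsupp.add_apply, Finsupp.single_eq_of_ne' (cast_ne_last _ _ _), add_zero,
      Finsupp.single_apply] at h
    split_ifs at h with h1
    · have : i' = i := congrArg Sigma.fst h1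
      subst this
      exact ⟨j, by simp⟩
    · exact absurd rfl h

lemma mem_Js (S : Set (Mon d m)) (s : Set (Fin d)) (p : Pp d m K) :
    p ∈ Js K S s ↔ ∀ μ ∈ p.support, ∃ g ∈ GG S s, g ≤ μ := mem_ideal_span_monomial_image

lemma coeff_th_mul (i : Fin d) (k : Fin (m i + 1)) (ν : Vtx d m →₀ ℕ)
    (hν : ν ⟨i, k⟩ ≠ 0) (hν' : ∀ k', k' ≠ k → ν ⟨i, k'⟩ = 0) (q : Pp d m K) :
    coeff ν (th K m i * q) = coeff (ν - Finsupp.single ⟨i, k⟩ 1) q ∨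
    coeff ν (th K m i * q) = - coeff (ν - Finsupp.single ⟨i, k⟩ 1) q := by
  classical
  rw [th, sub_mul, Finset.sum_mul, coeff_sub, coeff_sum]
  simp only [coeff_X_mul', Finsupp.mem_support_iff]
  revert hν hν'
  refine Fin.lastCases ?_ (fun j => ?_) k
  · intro hν hν'
    left
    rw [if_pos hν, Finset.sum_eq_zero, sub_zero]
    intro j _
    rw [if_neg]
    rw [not_not]
    exact hν' _ (Fin.castSucc_lt_last j).ne
  · intro hν hν'
    right
    rw [if_neg (not_not.2 (hν' _ (Fin.castSucc_lt_last j).ne')), Finset.sum_eq_single j, if_pos hν,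
      zero_sub]
    · intro j' _ hj
      rw [if_neg]
      rw [not_not]
      exact hν' _ (fun h => hj (Fin.castSucc_injective _ h))
    · intro h; exact absurd (Finset.mem_univ _) h

lemma reg_Js (S : Set (Mon d m)) (hS : ∀ u ∈ S, ColorSquarefree u) (s : Set (Fin d))
    (i : Fin d) (hi : i ∉ s) (q : Pp d m K) (hq : th K m i * q ∈ Js K S s) : q ∈ Js K S s := by
  classical
  rw [mem_Js] at hq ⊢
  intro μ hμ
  by_contra hN
  push Not at hN
  obtain ⟨k, h1, h2⟩ : ∃ k : Fin (m i + 1), (∀ k', k' ≠ k → μ ⟨i, k'⟩ = 0) ∧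
      (μ ⟨i, k⟩ = 0 → k = Fin.last (m i)) := by
    by_cases h : ∃ k : Fin (m i + 1), μ ⟨i, k⟩ ≠ 0
    · obtain ⟨k, hk⟩ := h
      refine ⟨k, ?_, fun h => absurd h hk⟩
      intro k' hk'
      by_contra h0
      have pair : ∀ a b : Vtx d m, a ≠ b → μ a ≠ 0 → μ b ≠ 0 →
          Finsupp.single a 1 + Finsupp.single b 1 ≤ μ := by
        intro a b hab ha hb c
        rw [Finsupp.add_apply, Finsupp.single_apply, Finsupp.single_apply]
        split_ifs with h1 h2 h2
        · exact absurd (h1.trans h2.symm) hab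
        · subst h1; omega
        · subst h2; omega
        · omega
      revert hk hk' h0
      refine Fin.lastCases ?_ (fun j => ?_) k <;> refine Fin.lastCases ?_ (fun j' => ?_) k'
      · intro _ h _; exact h rfl
      · intro hk hk' h0
        exact hN _ (Or.inr (Or.inr ⟨i, j', hi, rfl⟩)) (pair _ _ (cast_ne_last _ _ _).symm hk h0)
      · intro hk hk' h0
        exact hN _ (Or.inr (Or.inr ⟨i, j, hi, rfl⟩)) (pair _ _ (cast_ne_last _ _ _).symm h0 hk)
      · intro hk hk' h0
        have hne : j ≠ j' := fun h => hk' (by rw [h])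
        exact hN _ (Or.inr (Or.inl ⟨i, j, j', Or.inl hne, rfl⟩))
          (pair _ _ (fun h => hne (cast_inj h)) hk h0)
    · push Not at h
      exact ⟨Fin.last _, fun k' _ => h k', fun _ => rfl⟩
  set ν := μ + Finsupp.single (⟨i, k⟩ : Vtx d m) 1 with hν
  have hν1 : ν ⟨i, k⟩ ≠ 0 := by simp [hν]
  have hν2 : ∀ k', k' ≠ k → ν ⟨i, k'⟩ = 0 := by
    intro k' hk'
    rw [hν, Finsupp.add_apply, h1 k' hk', zero_add, Finsupp.single_eq_of_ne']
    intro h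
    simp only [Sigma.mk.injEq, heq_eq_eq, true_and] at h
    exact hk' h.symm
  have hsub : ν - Finsupp.single (⟨i, k⟩ : Vtx d m) 1 = μ := by simp [hν]
  have hc : coeff ν (th K m i * q) ≠ 0 := by
    have := mem_support_iff.1 hμ
    rcases coeff_th_mul K i k ν hν1 hν2 q with h | h <;> rw [h, hsub] <;> simpa using this
  obtain ⟨g, hg, hgν⟩ := hq ν (mem_support_iff.2 hc)
  apply hN g hg
  intro c
  by_cases hc : (⟨i, k⟩ : Vtx d m) = c
  · subst hc
    by_cases h0 : μ ⟨i, k⟩ = 0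
    · have hk := h2 h0
      subst hk
      by_cases hg0 : g ⟨i, Fin.last (m i)⟩ = 0
      · rw [hg0]; exact Nat.zero_le _
      · obtain ⟨j, hj⟩ := GG_last S s i g hg hg0
        exfalso
        have h3 := hgν ⟨i, j.castSucc⟩
        rw [hν2 _ (Fin.castSucc_lt_last j).ne] at h3
        omega
    · have := GG_le_one S hS s ⟨i, k⟩ hi g hg
      omega
  · have := hgν c
    rw [hν, Finsupp.add_apply, Finsupp.single_eq_of_ne' hc, add_zero] at this
    exact this

variable {K}

lemma rename_mon (u : Mon d m) : rename emb (mon K u) = monomial (Finsupp.mapDomain emb u) 1 := by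
  rw [mon, rename_monomial]

lemma map_span_mon (S : Set (Mon d m)) :
    Ideal.map (rename (emb : Var d m → Vtx d m)) (Ideal.span (mon K '' S)) =
      Ideal.span ((fun u => monomial (Finsupp.mapDomain emb u) (1 : K)) '' S) := by
  rw [Ideal.map_span, Set.image_image]
  simp only [rename_mon]

lemma phi_mon (s : Set (Fin d)) (u : Mon d m) :
    phi K m s (monomial (Finsupp.mapDomain emb u) 1) = monomial (Finsupp.mapDomain emb u) 1 := by
  rw [← rename_mon]
  have : (phi K m s).comp (rename emb) = rename emb := by
    apply MvPolynomial.algHom_ext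
    rintro ⟨i, j⟩
    rw [AlgHom.comp_apply, rename_X]
    exact phi_cast K s i j
  exact DFunLike.congr_fun this _

lemma XX (a b : Vtx d m) : (X a * X b : Pp d m K) =
    monomial (Finsupp.single a 1 + Finsupp.single b 1) 1 := by
  rw [X, X, monomial_mul, mul_one]

abbrev JJ (S : Set (Mon d m)) : Ideal (Pp d m K) :=
  extBr K (Ideal.span (mon K '' S)) ⊔ lastIdeal K

lemma mul_mem_Js (S : Set (Mon d m)) (s : Set (Fin d)) (i : Fin d) (j k : Fin (m i))
    (h : j ≠ k ∨ i ∈ s) :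
    X (⟨i, j.castSucc⟩ : Vtx d m) * X (⟨i, k.castSucc⟩ : Vtx d m) ∈ Js K S s := by
  rw [XX]
  exact Ideal.subset_span ⟨_, Or.inr (Or.inl ⟨i, j, k, h, rfl⟩), rfl⟩

lemma mem_J_sup (S : Set (Mon d m)) (s : Set (Fin d)) (p : Pp d m K) :
    p ∈ JJ S ⊔ Ts K m s ↔ phi K m s p ∈ Js K S s := by
  constructor
  · intro hp
    have : JJ S ⊔ Ts K m s ≤ (Js K S s).comap (phi K m s) := by
      refine sup_le (sup_le (sup_le ?_ ?_) ?_) ?_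
      · rw [map_span_mon, Ideal.span_le]
        rintro _ ⟨u, hu, rfl⟩
        rw [SetLike.mem_coe, Ideal.mem_comap]
        simp only [phi_mon]
        exact Ideal.subset_span ⟨_, Or.inl ⟨u, hu, rfl⟩, rfl⟩
      · rw [brIdeal, Ideal.span_le]
        rintro _ ⟨i, j, k, hjk, rfl⟩
        rw [SetLike.mem_coe, Ideal.mem_comap]
        rw [map_mul, phi_cast, phi_cast]
        exact mul_mem_Js S s i j k (Or.inl hjk.ne)
      · rw [lastIdeal, Ideal.span_le]
        rintro _ ⟨i, j, rfl⟩
        rw [SetLike.mem_coe, Ideal.mem_comap]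
        by_cases hi : i ∈ s
        · rw [map_mul, phi_cast, phi_last K s i hi, Finset.sum_mul]
          exact Ideal.sum_mem _ fun k _ => mul_mem_Js S s i k j (Or.inr hi)
        · rw [map_mul, phi_cast, phi_last' K s i hi, XX]
          exact Ideal.subset_span ⟨_, Or.inr (Or.inr ⟨i, j, hi, rfl⟩), rfl⟩
      · intro x hx
        rw [mem_Ts] at hx
        rw [Ideal.mem_comap]
        rw [hx]; exact Ideal.zero_mem _
    exact this hp
  · intro hp
    have hle : Js K S s ≤ JJ S ⊔ Ts K m s := by
      have hbr : ∀ (i : Fin d) (j k : Fin (m i)), j ≠ k →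
          X (⟨i, j.castSucc⟩ : Vtx d m) * X (⟨i, k.castSucc⟩ : Vtx d m) ∈ JJ S ⊔ Ts K m s := by
        intro i j k hjk
        apply Ideal.mem_sup_left; apply Ideal.mem_sup_left; apply Ideal.mem_sup_right
        rcases lt_or_gt_of_ne hjk with h | h
        · exact Ideal.subset_span ⟨i, j, k, h, rfl⟩
        · exact Ideal.subset_span ⟨i, k, j, h, mul_comm _ _⟩
      have hla : ∀ (i : Fin d) (j : Fin (m i)),
          X (⟨i, Fin.last (m i)⟩ : Vtx d m) * X (⟨i, j.castSucc⟩ : Vtx d m) ∈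
            JJ (K := K) S ⊔ Ts K m s := by
        intro i j
        apply Ideal.mem_sup_left; apply Ideal.mem_sup_right
        exact Ideal.subset_span ⟨i, j, rfl⟩
      rw [Js, Ideal.span_le]
      rintro _ ⟨g, hg, rfl⟩
      rcases hg with ⟨u, hu, rfl⟩ | ⟨i, j, k, hjk, rfl⟩ | ⟨i, j, hi, rfl⟩
      · apply Ideal.mem_sup_left; apply Ideal.mem_sup_left; apply Ideal.mem_sup_left
        rw [map_span_mon]
        exact Ideal.subset_span ⟨u, hu, rfl⟩
      · simp only [← XX]
        by_cases h : j = k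
        · subst h
          have hi : i ∈ s := hjk.resolve_left (fun h => h rfl)
          have e : (X (⟨i, j.castSucc⟩ : Vtx d m) * X (⟨i, j.castSucc⟩ : Vtx d m) : Pp d m K) =
              X (⟨i, Fin.last (m i)⟩ : Vtx d m) * X (⟨i, j.castSucc⟩ : Vtx d m)
              - (∑ k ∈ Finset.univ.erase j,
                X (⟨i, k.castSucc⟩ : Vtx d m) * X (⟨i, j.castSucc⟩ : Vtx d m))
              - th K m i * X (⟨i, j.castSucc⟩ : Vtx d m) := by
            rw [th, ← Finset.add_sum_erase _ _ (Finset.mem_univ j), ← Finset.sum_mul]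
            ring
          rw [e]
          refine Ideal.sub_mem _ (Ideal.sub_mem _ (hla i j) (Ideal.sum_mem _ fun k hk => ?_)) ?_
          · exact hbr i k j (Finset.ne_of_mem_erase hk)
          · exact Ideal.mul_mem_right _ _ (Ideal.mem_sup_right (Ideal.subset_span ⟨i, hi, rfl⟩))
        · exact hbr i j k h
      · simp only [← XX]
        exact hla i j
    have h1 := hle hp
    have h2 : p - phi K m s p ∈ JJ S ⊔ Ts K m s := Ideal.mem_sup_right (phi_sub K s p)
    simpa using Ideal.add_mem _ h2 h1

lemma reg_J (S : Set (Mon d m)) (hS : ∀ u ∈ S, ColorSquarefree u) (s : Set (Fin d))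
    (i : Fin d) (hi : i ∉ s) : Reg (th K m i) (JJ S ⊔ Ts K m s) := by
  intro f hf
  rw [mem_J_sup, smul_eq_mul, map_mul, phi_th' K s i hi] at hf
  rw [mem_J_sup]
  exact reg_Js K S hS s i hi _ hf

lemma th_homog (i : Fin d) : IsWeightedHomogeneous wW (th K m i) (Finsupp.single i 1) := by
  refine IsWeightedHomogeneous.sub (isWeightedHomogeneous_X K wW _) ?_
  exact IsWeightedHomogeneous.sum _ _ _ fun j _ => isWeightedHomogeneous_X K wW _

lemma hom_Ts (s : Set (Fin d)) : (gmR (Finsupp.weight wW)).Hom (Ts K m s) := by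
  apply hom_span
  rintro _ ⟨i, _, rfl⟩
  exact ⟨_, fun μ h => th_homog i h⟩

lemma hom_sup {σ : Type} {δ : (σ →₀ ℕ) →+ DD d} {A B : Ideal (MvPolynomial σ K)}
    (hA : (gmR δ).Hom A) (hB : (gmR δ).Hom B) : (gmR δ).Hom (A ⊔ B) := by
  intro a x hx
  obtain ⟨y, hy, z, hz, rfl⟩ := Submodule.mem_sup.1 hx
  rw [map_add]
  exact Submodule.add_mem_sup (hA a y hy) (hB a z hz)

lemma hom_J (S : Set (Mon d m)) : (gmR (Finsupp.weight wW)).Hom (JJ S : Ideal (Pp d m K)) := by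
  have hm : ∀ g : Vtx d m →₀ ℕ, ∃ e, ∀ μ, coeff μ (monomial g (1 : K)) ≠ 0 →
      Finsupp.weight wW μ = e := fun g =>
    ⟨_, fun μ h => isWeightedHomogeneous_monomial wW g (1 : K) rfl h⟩
  refine hom_sup (hom_sup ?_ ?_) ?_
  · rw [map_span_mon]
    apply hom_span
    rintro _ ⟨u, _, rfl⟩
    exact hm _
  · apply hom_span
    rintro _ ⟨i, j, k, _, rfl⟩
    rw [XX]; exact hm _
  · apply hom_span
    rintro _ ⟨i, j, rfl⟩
    rw [XX]; exact hm _

lemma Ts_insert (s : Set (Fin d)) (i : Fin d) :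
    Ts K m (insert i s) = Ts K m s ⊔ Ideal.span {th K m i} := by
  rw [Ts, Set.image_insert_eq, Ideal.span_insert, sup_comm]; rfl

lemma RM_all (S : Set (Mon d m)) (hS : ∀ u ∈ S, ColorSquarefree u) (β : ℕ → DD d → ℕ)
    (s : Finset (Fin d)) :
    RM (Finsupp.weight wW) (JJ S : Ideal (Pp d m K)) ⊥ β ↔
    RM (Finsupp.weight wW) (JJ S ⊔ Ts K m s) (Ts K m s) β := by
  classical
  induction s using Finset.induction_on with
  | empty => simp [Ts]
  | insert i s hi ih =>
    rw [ih, Finset.coe_insert, Ts_insert, ← sup_assoc]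
    have hi' : i ∉ (s : Set (Fin d)) := by simpa using hi
    constructor
    · exact RM_down _ β (reg_Ts K _ i hi') (reg_J S hS _ i hi')
    · exact RM_up _ (Finsupp.single i 1) (by simp) (fun μ h => th_homog i h) β le_sup_right
        (hom_Ts _) (hom_sup (hom_J S) (hom_Ts _)) (reg_Ts K _ i hi') (reg_J S hS _ i hi')

/-- the projection to `P` -/
def pii : Pp d m K →ₐ[K] PR d m K :=
  aeval (fun v : Vtx d m => Fin.lastCases (motive := fun _ => PR d m K)
    (∑ j : Fin (m v.1), X (⟨v.1, j⟩ : Var d m)) (fun j => X (⟨v.1, j⟩ : Var d m)) v.2)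

lemma pii_last (i : Fin d) : pii (X (⟨i, Fin.last (m i)⟩ : Vtx d m)) =
    (∑ j : Fin (m i), X (⟨i, j⟩ : Var d m) : PR d m K) := by
  simp [pii]

lemma pii_cast (i : Fin d) (j : Fin (m i)) : pii (X (⟨i, j.castSucc⟩ : Vtx d m)) =
    (X (⟨i, j⟩ : Var d m) : PR d m K) := by
  simp [pii]

lemma pii_rename (p : PR d m K) : pii (rename emb p) = p := by
  have : (pii (K := K)).comp (rename (emb : Var d m → Vtx d m)) = AlgHom.id K _ := by
    apply MvPolynomial.algHom_ext
    rintro ⟨i, j⟩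
    rw [AlgHom.comp_apply, rename_X]
    exact pii_cast i j
  exact DFunLike.congr_fun this p

lemma rename_pii (p : Pp d m K) : rename emb (pii p) = phi K m Set.univ p := by
  have : (rename (emb : Var d m → Vtx d m)).comp (pii (K := K)) = phi K m Set.univ := by
    apply MvPolynomial.algHom_ext
    rintro ⟨i, k⟩
    rw [AlgHom.comp_apply]
    refine Fin.lastCases ?_ (fun j => ?_) k
    · rw [pii_last, phi_last K Set.univ i (Set.mem_univ i), map_sum]
      simp only [rename_X]; rfl
    · rw [pii_cast, phi_cast, rename_X]; rfl
  exact DFunLike.congr_fun this p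

lemma XXV (i : Fin d) (j k : Fin (m i)) : (X (⟨i, j⟩ : Var d m) * X (⟨i, k⟩ : Var d m) : PR d m K) =
    mon K (xvar i j + xvar i k) := by
  rw [X, X, monomial_mul, mul_one]; rfl

lemma mem_J_univ (S : Set (Mon d m)) (p : Pp d m K) :
    p ∈ JJ S ⊔ Ts K m Set.univ ↔ pii p ∈ Ideal.span (mon K '' S) ⊔ sqIdeal K := by
  constructor
  · intro hp
    have hsq : ∀ (i : Fin d) (j k : Fin (m i)),
        (X (⟨i, j⟩ : Var d m) * X (⟨i, k⟩ : Var d m) : PR d m K) ∈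
          Ideal.span (mon K '' S) ⊔ sqIdeal K := fun i j k =>
      Ideal.mem_sup_right (Ideal.subset_span ⟨i, j, k, XXV i j k⟩)
    have : JJ S ⊔ Ts K m Set.univ ≤ (Ideal.span (mon K '' S) ⊔ sqIdeal K).comap pii := by
      refine sup_le (sup_le (sup_le ?_ ?_) ?_) ?_
      · rw [Ideal.map_le_iff_le_comap]
        intro x hx
        rw [Ideal.mem_comap, Ideal.mem_comap, pii_rename]
        exact Ideal.mem_sup_left hx
      · rw [brIdeal, Ideal.span_le]
        rintro _ ⟨i, j, k, hjk, rfl⟩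
        rw [SetLike.mem_coe, Ideal.mem_comap]
        rw [map_mul, pii_cast, pii_cast]
        exact hsq i j k
      · rw [lastIdeal, Ideal.span_le]
        rintro _ ⟨i, j, rfl⟩
        rw [SetLike.mem_coe, Ideal.mem_comap]
        rw [map_mul, pii_cast, pii_last, Finset.sum_mul]
        exact Ideal.sum_mem _ fun k _ => hsq i k j
      · rw [Ts, Ideal.span_le]
        rintro _ ⟨i, _, rfl⟩
        rw [SetLike.mem_coe, Ideal.mem_comap]
        rw [th, map_sub, map_sum, pii_last]
        simp only [pii_cast, sub_self]
        exact Ideal.zero_mem _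
    exact this hp
  · intro hp
    rw [mem_J_sup, ← rename_pii]
    have : Ideal.span (mon K '' S) ⊔ sqIdeal K ≤ (Js K S Set.univ).comap (rename emb) := by
      refine sup_le ?_ ?_
      · rw [Ideal.span_le]
        rintro _ ⟨u, hu, rfl⟩
        rw [SetLike.mem_coe, Ideal.mem_comap]
        rw [rename_mon]
        exact Ideal.subset_span ⟨_, Or.inl ⟨u, hu, rfl⟩, rfl⟩
      · rw [sqIdeal, Ideal.span_le]
        rintro _ ⟨i, j, k, rfl⟩
        rw [SetLike.mem_coe, Ideal.mem_comap]
        rw [← XXV, map_mul, rename_X, rename_X]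
        exact mul_mem_Js S _ i j k (Or.inr (Set.mem_univ i))
    exact this hp

lemma mem_T_univ (p : Pp d m K) : p ∈ Ts K m Set.univ ↔ pii p = 0 := by
  rw [mem_Ts, ← rename_pii]
  exact map_eq_zero_iff _ (rename_injective _ emb_inj)

lemma pii_coeff0 (p : Pp d m K) : coeff 0 (pii p) = coeff 0 p := by
  have : (aeval (fun _ => (0 : K))).comp (pii (K := K) (m := m)) = aeval (fun _ => (0 : K)) := by
    apply MvPolynomial.algHom_ext
    rintro ⟨i, k⟩
    rw [AlgHom.comp_apply]
    refine Fin.lastCases ?_ (fun j => ?_) k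
    · rw [pii_last, map_sum]; simp
    · rw [pii_cast]; simp
  have h := DFunLike.congr_fun this p
  rw [AlgHom.comp_apply] at h
  simpa [aeval_zero', constantCoeff_eq] using h

lemma pii_homog : HomogMap (Finsupp.weight wW) (Finsupp.weight wV) (pii (K := K) (m := m)) := by
  apply homogMap_of
  rintro ⟨i, k⟩
  refine Fin.lastCases ?_ (fun j => ?_) k
  · rw [pii_last]
    exact IsWeightedHomogeneous.sum _ _ _ fun j _ => isWeightedHomogeneous_X K wV _
  · rw [pii_cast]
    exact isWeightedHomogeneous_X K wV _

lemma ren_homog : HomogMap (Finsupp.weight wV) (Finsupp.weight wW)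
    (rename (R := K) (emb : Var d m → Vtx d m)) := by
  apply homogMap_of
  rintro v
  rw [rename_X]
  exact isWeightedHomogeneous_X K wW _

theorem main_iff (S : Set (Mon d m)) (hS : ∀ u ∈ S, ColorSquarefree u) (β : ℕ → DD d → ℕ) :
    IsMinFreeRes (Vtx d m) K degcW (JJ S) β ↔
    IsMinFreeRes (Var d m) K degcV (Ideal.span (mon K '' S) ⊔ sqIdeal K) β := by
  rw [degcV_eq, degcW_eq, ← RM_bot, ← RM_bot, RM_all S hS β Finset.univ, Finset.coe_univ]
  exact transfer pii (rename emb) pii_rename pii_homog ren_homog pii_coeff0 _ _ _ mem_T_univ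
    (mem_J_univ S) β

end Comb

/-- Theorem `thm:compare Betti numbers`.  Let `I ⊆ P(d,m)` be a
color-squarefree monomial ideal.  Then `I + 𝔪_1^{[2]} + ⋯ + 𝔪_d^{[2]} + Σ_i x_{i,m_i+1}𝔪_i`
(in `P' = P(d,m+(1,…,1))`) and `I + 𝔪_1² + ⋯ + 𝔪_d²` (in `P`) have the same `ℤ^d`-graded
Betti numbers: a table `β` is the table of minimal `ℤ^d`-graded Betti numbers of the one
iff it is that of the other. -/
theorem statement_19 {d : ℕ} {m : Fin d → ℕ} (K : Type*) [Field K]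
    (I : Ideal (PR d m K))
    (hcsf : ∃ S : Set (Mon d m), (∀ u ∈ S, ColorSquarefree u) ∧
      I = Ideal.span (mon K '' S)) :
    ∀ β : ℕ → (Fin d →₀ ℕ) → ℕ,
      IsMinFreeRes (Vtx d m) K degcW (extBr K I ⊔ lastIdeal K) β ↔
      IsMinFreeRes (Var d m) K degcV (I ⊔ sqIdeal K) β := by
  obtain ⟨S, hS, rfl⟩ := hcsf
  intro β
  exact main_iff S hS β

end BalSq
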